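/- The only pairs (x, y) ∈ ℚ × ℚ satisfying y² = x⁶ − 2x⁵ + 3x⁴ − 4x³ − x² + 2x + 1 are (x, y) ∈ {(0, 1), (0, −1), (1, 0)}. -/

import Mathlib

/-- Coefficientwise form of `e² + μ e - μ² F = a c²`. -/
def Halving {R : Type*} [CommRing R] (μ e3 e2 e1 e0 a1 a2 c0 c1 c2 : R) : Prop :=
  e3 ^ 2 = c0 ^ 2 ∧
  2 * e3 * e2 - μ ^ 2 = 2 * c0 * c1 + a1 * c0 ^ 2 ∧
  e2 ^ 2 + 2 * e3 * e1 = c1 ^ 2 + 2 * c0 * c2 + 2 * c0 * c1 * a1 + a2 * c0 ^ 2 ∧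
  2 * e3 * e0 + 2 * e2 * e1 + μ * e3 + 2 * μ ^ 2 =
    2 * c1 * c2 + a1 * (c1 ^ 2 + 2 * c0 * c2) + 2 * c0 * c1 * a2 ∧
  e1 ^ 2 + 2 * e2 * e0 + μ * e2 - 2 * μ ^ 2 =
    c2 ^ 2 + 2 * c1 * c2 * a1 + a2 * (c1 ^ 2 + 2 * c0 * c2) ∧
  2 * e1 * e0 + μ * e1 + μ ^ 2 = a1 * c2 ^ 2 + 2 * c1 * c2 * a2 ∧
  e0 ^ 2 + μ * e0 = a2 * c2 ^ 2

lemma contraction_aux {R : Type*} [CommRing R] (hu : ∀ x : R, IsUnit (1 + 2 * x))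
    (q q' k e3 e2 e1 e0 a1 a2 c1 c2 α1 α2 κ1 κ2 d0 d3 : R) (hq : q = 2 * q')
    (E6 : e3 ^ 2 = k)
    (E5 : 2 * e3 * e2 - 1 = k * (2 * c1 + a1))
    (E4 : e2 ^ 2 + 2 * e3 * e1 = k * (c1 ^ 2 + 2 * c2 + 2 * c1 * a1 + a2))
    (E3 : 2 * e3 * e0 + 2 * e2 * e1 + e3 + 2 =
      k * (2 * c1 * c2 + a1 * (c1 ^ 2 + 2 * c2) + 2 * c1 * a2))
    (E2 : e1 ^ 2 + 2 * e2 * e0 + e2 - 2 =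
      k * (c2 ^ 2 + 2 * c1 * c2 * a1 + a2 * (c1 ^ 2 + 2 * c2)))
    (E1 : 2 * e1 * e0 + e1 + 1 = k * (a1 * c2 ^ 2 + 2 * c1 * c2 * a2))
    (E0 : e0 ^ 2 + e0 = k * (a2 * c2 ^ 2))
    (ha1 : a1 + 1 = q * α1) (ha2 : a2 = q * α2) (hc1 : c1 + 1 = q * κ1) (hc2 : c2 = q * κ2)
    (he3 : e3 + 1 = 2 * d3) (he0 : e0 = 2 * d0) :
    2 * q ∣ a1 + 1 ∧ 2 * q ∣ a2 := by
  have h0 : q ∣ e0 := by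
    have h : q ∣ (1 + 2 * d0) * e0 := ⟨k * (α2 * c2 ^ 2), by
      linear_combination E0 - e0 * he0 + k * c2 ^ 2 * ha2⟩
    exact ((hu d0).dvd_mul_left).1 h
  obtain ⟨f0, hf0⟩ := h0
  have h1 : q ∣ e1 + 1 := ⟨k * (a1 * κ2 * c2 + 2 * c1 * κ2 * a2) - 2 * e1 * f0, by
    linear_combination E1 - 2 * e1 * hf0 + k * (a1 * c2 + 2 * c1 * a2) * hc2⟩
  obtain ⟨f1, hf1⟩ := h1
  have h2 : q ∣ e2 - 1 := ⟨k * (c2 * κ2 + 2 * c1 * κ2 * a1 + α2 * (c1 ^ 2 + 2 * c2))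
      - 2 * e2 * f0 - (e1 - 1) * f1, by
    linear_combination E2 - 2 * e2 * hf0 - (e1 - 1) * hf1 + k * (c2 + 2 * c1 * a1) * hc2
      + k * (c1 ^ 2 + 2 * c2) * ha2⟩
  obtain ⟨f2, hf2⟩ := h2
  have h3 : q ∣ e3 + 1 := by
    have h : q ∣ (1 + 2 * (-d3)) * (e3 + 1) := by
      refine ⟨-(k * (2 * c1 * κ2 + α1 * (c1 ^ 2 + 2 * c2) - (c1 - 1) * κ1 - 2 * κ2 + 2 * c1 * α2)
        - 2 * e3 * f0 - 2 * e2 * f1 + 2 * f2), ?_⟩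
      linear_combination -E3 + 2 * e3 * hf0 + 2 * e2 * hf1 - 2 * hf2
        - k * 2 * c1 * hc2 - k * (c1 ^ 2 + 2 * c2) * ha1 + k * (c1 - 1) * hc1 + k * 2 * hc2
        - k * 2 * c1 * ha2 + (e3 + 1) * he3 - E6
    exact ((hu (-d3)).dvd_mul_left).1 h
  obtain ⟨f3, hf3⟩ := h3
  have hk : k - 1 = 2 * q * (-f3 + q' * f3 ^ 2) := by
    have : e3 = -1 + q * f3 := by linear_combination hf3
    rw [← E6, this]; linear_combination q * f3 ^ 2 * hq
  constructor
  · refine ⟨-(-f3 + q' * f3 ^ 2) * (2 * c1 + a1) + e2 * f3 - f2 - κ1, ?_⟩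
    linear_combination (-1) * E5 - (2 * c1 + a1) * hk + 2 * e2 * hf3 - 2 * hf2 - 2 * hc1
  · refine ⟨-(-f3 + q' * f3 ^ 2) * (c1 ^ 2 + 2 * c2 + 2 * c1 * a1 + a2)
      + (f2 + q' * f2 ^ 2) + (f3 * e1 - f1) - (-κ1 + q' * κ1 ^ 2) - κ2 - (c1 * α1 - κ1), ?_⟩
    have t2 : e2 ^ 2 - 1 = 2 * q * (f2 + q' * f2 ^ 2) := by
      have : e2 = 1 + q * f2 := by linear_combination hf2
      rw [this]; linear_combination q * f2 ^ 2 * hq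
    have t1 : c1 ^ 2 - 1 = 2 * q * (-κ1 + q' * κ1 ^ 2) := by
      have : c1 = -1 + q * κ1 := by linear_combination hc1
      rw [this]; linear_combination q * κ1 ^ 2 * hq
    linear_combination (-1) * E4 - (c1 ^ 2 + 2 * c2 + 2 * c1 * a1 + a2) * hk + t2
      + 2 * e1 * hf3 - 2 * hf1 - t1 - 2 * hc2 - 2 * c1 * ha1 + 2 * hc1

/-- The ring of `2`-integral rationals. -/
noncomputable def A2 : Subring ℚ := (PadicInt.subring 2).comap (Rat.castHom ℚ_[2])

lemma A2.coe_two : ((2 : A2) : ℚ) = 2 := rfl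

lemma mem_A2 {q : ℚ} : q ∈ A2 ↔ ‖(q : ℚ_[2])‖ ≤ 1 := Iff.rfl

/-- Inclusion into the `2`-adic integers. -/
noncomputable def A2.toZ2 : A2 →+* ℤ_[2] where
  toFun x := ⟨((x : ℚ) : ℚ_[2]), mem_A2.1 x.2⟩
  map_one' := by apply Subtype.ext; simp
  map_zero' := by apply Subtype.ext; simp
  map_add' x y := by
    apply Subtype.ext
    change (((x + y : A2) : ℚ) : ℚ_[2]) = ((x : ℚ) : ℚ_[2]) + ((y : ℚ) : ℚ_[2])
    push_cast; rfl
  map_mul' x y := by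
    apply Subtype.ext
    change (((x * y : A2) : ℚ) : ℚ_[2]) = ((x : ℚ) : ℚ_[2]) * ((y : ℚ) : ℚ_[2])
    push_cast; rfl

/-- Reduction modulo `2`. -/
noncomputable def A2.red : A2 →+* ZMod 2 := (PadicInt.toZMod (p := 2)).comp A2.toZ2

lemma A2.norm_lt {x : A2} (h : A2.red x = 0) : ‖((x : ℚ) : ℚ_[2])‖ < 1 := by
  have h1 : A2.toZ2 x ∈ RingHom.ker (PadicInt.toZMod (p := 2)) := h
  rw [PadicInt.ker_toZMod, PadicInt.maximalIdeal_eq_span_p] at h1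
  have h2 := (PadicInt.norm_lt_one_iff_dvd (p := 2) (A2.toZ2 x)).2
    (Ideal.mem_span_singleton.1 h1)
  exact h2

lemma A2.two_dvd {x : A2} (h : A2.red x = 0) : (2 : A2) ∣ x := by
  have h1 : A2.toZ2 x ∈ RingHom.ker (PadicInt.toZMod (p := 2)) := h
  rw [PadicInt.ker_toZMod, PadicInt.maximalIdeal_eq_span_p] at h1
  obtain ⟨y, hy⟩ := Ideal.mem_span_singleton.1 h1
  have hy' : (((x : ℚ) : ℚ_[2])) = 2 * (y : ℚ_[2]) := by
    have := congrArg (fun z : ℤ_[2] => (z : ℚ_[2])) hy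
    rw [PadicInt.coe_mul] at this
    exact this
  have hm : ((x : ℚ) / 2) ∈ A2 := by
    rw [mem_A2]; push_cast; rw [hy', mul_div_cancel_left₀ _ two_ne_zero]; exact y.2
  exact ⟨⟨_, hm⟩, by apply Subtype.ext; rw [Subring.coe_mul, A2.coe_two]; ring⟩

lemma A2.red_of_dvd {x : A2} (h : (2 : A2) ∣ x) : A2.red x = 0 := by
  obtain ⟨y, rfl⟩ := h
  rw [map_mul, map_ofNat]; 
  have : (2 : ZMod 2) = 0 := by decide
  rw [this, zero_mul]

lemma A2.isUnit {x : A2} (h : A2.red x ≠ 0) : IsUnit x := by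
  have hn : ‖((x : ℚ) : ℚ_[2])‖ = 1 := by
    have hx : ‖((x : ℚ) : ℚ_[2])‖ ≤ 1 := x.2
    refine le_antisymm hx (not_lt.1 fun hlt => h ?_)
    have h2 := (PadicInt.norm_lt_one_iff_dvd (p := 2) (A2.toZ2 x)).1 hlt
    have : A2.toZ2 x ∈ RingHom.ker (PadicInt.toZMod (p := 2)) := by
      rw [PadicInt.ker_toZMod, PadicInt.maximalIdeal_eq_span_p]
      exact Ideal.mem_span_singleton.2 h2
    exact this
  have hx0 : (x : ℚ) ≠ 0 := by
    intro h0; rw [h0] at hn; simp at hn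
  have hm : ((x : ℚ)⁻¹) ∈ A2 := by
    rw [mem_A2]; push_cast; rw [norm_inv, hn]; simp
  exact IsUnit.of_mul_eq_one ⟨_, hm⟩ (by apply Subtype.ext; push_cast; exact mul_inv_cancel₀ hx0)

lemma A2.unit_odd (x : A2) : IsUnit (1 + 2 * x) := by
  apply A2.isUnit
  rw [map_add, A2.red_of_dvd (Dvd.intro _ rfl), map_one]; decide

lemma A2.eq_zero {x : A2} (h : ∀ m : ℕ, (2 : A2) ^ m ∣ x) : x = 0 := by
  have hz : ‖((x : ℚ) : ℚ_[2])‖ ≤ 0 := by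
    have hb : ∀ m : ℕ, ‖((x : ℚ) : ℚ_[2])‖ ≤ (1 / 2 : ℝ) ^ m := by
      intro m
      obtain ⟨y, rfl⟩ := h m
      have hy : ‖((y : ℚ) : ℚ_[2])‖ ≤ 1 := y.2
      have h2 : ‖(2 : ℚ_[2])‖ = 1 / 2 := by
        have := Padic.norm_p (p := 2); simpa using this
      rw [Subring.coe_mul, Subring.coe_pow, A2.coe_two]
      push_cast
      rw [norm_mul, norm_pow, h2]
      calc (1 / 2 : ℝ) ^ m * ‖((y : ℚ) : ℚ_[2])‖ ≤ (1 / 2 : ℝ) ^ m * 1 := by gcongr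
        _ = _ := mul_one _
    exact ge_of_tendsto' (tendsto_pow_atTop_nhds_zero_of_lt_one (by norm_num) (by norm_num)) hb
  have := norm_le_zero_iff.1 hz
  apply Subtype.ext
  exact_mod_cast this

/-- The set `S`. -/
def InS (a1 a2 : A2) (b0 b1 w2 w1 w0 : A2) : Prop :=
  0 = -(w2 + a1) ∧ 2 = -(w1 + a1 * w2 + a2) ∧ b1 ^ 2 - 2 = -(w0 + a1 * w1 + a2 * w2) ∧
  2 * b1 * b0 + b1 + 1 = -(a1 * w0 + a2 * w1) ∧ b0 ^ 2 + b0 = -(a2 * w0) ∧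
  A2.red a1 = 1 ∧ A2.red a2 = 0 ∧ A2.red b1 = 1

lemma Halving.map {R S : Type*} [CommRing R] [CommRing S] (f : R →+* S)
    {μ e3 e2 e1 e0 a1 a2 c0 c1 c2 : R} (h : Halving μ e3 e2 e1 e0 a1 a2 c0 c1 c2) :
    Halving (f μ) (f e3) (f e2) (f e1) (f e0) (f a1) (f a2) (f c0) (f c1) (f c2) := by
  obtain ⟨h1, h2, h3, h4, h5, h6, h7⟩ := h
  refine ⟨?_, ?_, ?_, ?_, ?_, ?_, ?_⟩
  · simpa [map_ofNat] using congrArg f h1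
  · simpa [map_ofNat] using congrArg f h2
  · simpa [map_ofNat] using congrArg f h3
  · simpa [map_ofNat] using congrArg f h4
  · simpa [map_ofNat] using congrArg f h5
  · simpa [map_ofNat] using congrArg f h6
  · simpa [map_ofNat] using congrArg f h7

instance (μ e3 e2 e1 e0 a1 a2 c0 c1 c2 : ZMod 2) :
    Decidable (Halving μ e3 e2 e1 e0 a1 a2 c0 c1 c2) := by
  unfold Halving; infer_instance

set_option synthInstance.maxSize 2000 in
set_option synthInstance.maxHeartbeats 400000 in
set_option maxRecDepth 10000 in
lemma mod_two_aux : ∀ μ l1 l0 b0 c0 c1 c2 : ZMod 2,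
    Halving μ l1 (l0 + 1 * l1) (μ * 1 + 1 * l0 + 0 * l1) (μ * b0 + 0 * l0) 1 0 c0 c1 c2 →
    ¬ (μ = 0 ∧ l1 = 0 ∧ l0 = 0 ∧ c0 = 0 ∧ c1 = 0 ∧ c2 = 0) →
    μ = 1 ∧ l1 = 1 ∧ l0 = 0 ∧ c0 = 1 ∧ c1 = 1 ∧ c2 = 0 := by
  decide

lemma exists_scale (v : Fin 6 → ℚ) (h : v ≠ 0) : ∃ t : ℚ, t ≠ 0 ∧ ∃ z : Fin 6 → A2,
    (∀ i, (z i : ℚ) = t * v i) ∧ ∃ i, z i = 1 := by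
  obtain ⟨i, hi⟩ := Finite.exists_max (fun i => ‖(v i : ℚ_[2])‖)
  have hv : v i ≠ 0 := by
    intro h0
    apply h
    funext j
    have := hi j
    simp only [h0, Rat.cast_zero, norm_zero] at this
    have h3 := norm_le_zero_iff.1 this
    exact_mod_cast h3
  have hv' : (0 : ℝ) < ‖(v i : ℚ_[2])‖ := norm_pos_iff.2 (by exact_mod_cast hv)
  refine ⟨(v i)⁻¹, inv_ne_zero hv, fun j => ⟨(v i)⁻¹ * v j, ?_⟩, fun j => rfl, i, ?_⟩
  · rw [mem_A2]; push_cast; rw [norm_mul, norm_inv, inv_mul_le_iff₀ hv', mul_one]; exact hi j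
  · apply Subtype.ext; push_cast; exact inv_mul_cancel₀ hv

lemma Halving.scale {R : Type*} [CommRing R] (t : R)
    {μ e3 e2 e1 e0 a1 a2 c0 c1 c2 : R} (h : Halving μ e3 e2 e1 e0 a1 a2 c0 c1 c2) :
    Halving (t * μ) (t * e3) (t * e2) (t * e1) (t * e0) a1 a2 (t * c0) (t * c1) (t * c2) := by
  obtain ⟨h1, h2, h3, h4, h5, h6, h7⟩ := h
  refine ⟨?_, ?_, ?_, ?_, ?_, ?_, ?_⟩
  · linear_combination t ^ 2 * h1
  · linear_combination t ^ 2 * h2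
  · linear_combination t ^ 2 * h3
  · linear_combination t ^ 2 * h4
  · linear_combination t ^ 2 * h5
  · linear_combination t ^ 2 * h6
  · linear_combination t ^ 2 * h7

lemma Halving.of_coe {μ e3 e2 e1 e0 a1 a2 c0 c1 c2 : A2}
    (h : Halving (μ : ℚ) e3 e2 e1 e0 a1 a2 c0 c1 c2) :
    Halving μ e3 e2 e1 e0 a1 a2 c0 c1 c2 := by
  obtain ⟨h1, h2, h3, h4, h5, h6, h7⟩ := h
  exact ⟨Subtype.ext h1, Subtype.ext h2, Subtype.ext h3, Subtype.ext h4, Subtype.ext h5,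
    Subtype.ext h6, Subtype.ext h7⟩

/-- The outcome of halving an element of `S`. -/
def HalfProp : Prop := ∀ a1 a2 b0 b1 w2 w1 w0 : A2, InS a1 a2 b0 b1 w2 w1 w0 →
  ∃ v : Fin 6 → ℚ, v ≠ 0 ∧ Halving (v 0) (v 1) (v 2 + a1 * v 1)
    (v 0 * b1 + a1 * v 2 + a2 * v 1) (v 0 * b0 + a2 * v 2) (a1 : ℚ) (a2 : ℚ) (v 3) (v 4) (v 5)

/-- Normalised halving data. -/
def Norm2 (e3 e2 e1 e0 k a1 a2 c1 c2 : A2) : Prop :=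
  e3 ^ 2 = k ∧ 2 * e3 * e2 - 1 = k * (2 * c1 + a1) ∧
  e2 ^ 2 + 2 * e3 * e1 = k * (c1 ^ 2 + 2 * c2 + 2 * c1 * a1 + a2) ∧
  2 * e3 * e0 + 2 * e2 * e1 + e3 + 2 =
      k * (2 * c1 * c2 + a1 * (c1 ^ 2 + 2 * c2) + 2 * c1 * a2) ∧
  e1 ^ 2 + 2 * e2 * e0 + e2 - 2 =
      k * (c2 ^ 2 + 2 * c1 * c2 * a1 + a2 * (c1 ^ 2 + 2 * c2)) ∧
  2 * e1 * e0 + e1 + 1 = k * (a1 * c2 ^ 2 + 2 * c1 * c2 * a2) ∧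
  e0 ^ 2 + e0 = k * (a2 * c2 ^ 2)

lemma base_step (H : HalfProp) {a1 a2 b0 b1 w2 w1 w0 : A2} (h : InS a1 a2 b0 b1 w2 w1 w0) :
    ∃ e3 e2 e1 e0 k c1 c2 : A2, Norm2 e3 e2 e1 e0 k a1 a2 c1 c2 ∧
      A2.red e3 = 1 ∧ A2.red e2 = 1 ∧ A2.red e1 = 1 ∧ A2.red e0 = 0 ∧
      A2.red c1 = 1 ∧ A2.red c2 = 0 := by
  obtain ⟨v, hv, hH⟩ := H _ _ _ _ _ _ _ h
  obtain ⟨-, -, -, -, -, ha1, ha2, hb1⟩ := h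
  obtain ⟨t, ht, z, hz, i, hi⟩ := exists_scale v hv
  have hA : Halving (z 0) (z 1) (z 2 + a1 * z 1)
    (z 0 * b1 + a1 * z 2 + a2 * z 1) (z 0 * b0 + a2 * z 2) a1 a2 (z 3) (z 4) (z 5) := by
    apply Halving.of_coe
    push_cast
    simp only [hz]
    convert hH.scale t using 1 <;> ring
  have hR := hA.map A2.red
  simp only [map_add, map_mul, ha1, ha2, hb1] at hR
  have hne : ¬ (A2.red (z 0) = 0 ∧ A2.red (z 1) = 0 ∧ A2.red (z 2) = 0 ∧ A2.red (z 3) = 0 ∧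
      A2.red (z 4) = 0 ∧ A2.red (z 5) = 0) := by
    rintro ⟨g0, g1, g2, g3, g4, g5⟩
    have : A2.red (z i) = 0 := by fin_cases i <;> assumption
    rw [hi, map_one] at this
    exact one_ne_zero this
  obtain ⟨r0, r1, r2, r3, r4, r5⟩ := mod_two_aux _ _ _ _ _ _ _ hR hne
  have u0 : IsUnit (z 0) := A2.isUnit (by rw [r0]; decide)
  have u3 : IsUnit (z 3) := A2.isUnit (by rw [r3]; decide)
  obtain ⟨x, hx⟩ := u0.exists_right_inv
  obtain ⟨y, hy⟩ := u3.exists_right_inv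
  have rx : A2.red x = 1 := by
    have := congrArg A2.red hx; rw [map_mul, r0, one_mul, map_one] at this; exact this
  have ry : A2.red y = 1 := by
    have := congrArg A2.red hy; rw [map_mul, r3, one_mul, map_one] at this; exact this
  obtain ⟨h6, h5, h4, h3, h2, h1, h0⟩ := hA.scale x
  have hx2 : z 0 ^ 2 * x ^ 2 = 1 := by rw [← mul_pow, hx, one_pow]
  set e3 := x * z 1
  set e2 := x * (z 2 + a1 * z 1)
  set e1 := x * (z 0 * b1 + a1 * z 2 + a2 * z 1)
  set e0 := x * (z 0 * b0 + a2 * z 2) with he0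
  have hN : Norm2 e3 e2 e1 e0 ((x * z 3) ^ 2) a1 a2 (y * z 4) (y * z 5) := by
    have hx' : x * z 0 = 1 := by rw [mul_comm]; exact hx
    have e4 : x * z 4 = (x * z 3) * (y * z 4) := by linear_combination (-x * z 4) * hy
    have e5 : x * z 5 = (x * z 3) * (y * z 5) := by linear_combination (-x * z 5) * hy
    simp only [hx', e4, e5] at h5 h4 h3 h2 h1 h0
    exact ⟨h6, by linear_combination h5, by linear_combination h4, by linear_combination h3,
      by linear_combination h2, by linear_combination h1, by linear_combination h0⟩
  have q3 : A2.red e3 = 1 := by simp only [e3, map_mul, rx, r1]; decide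
  have q2 : A2.red e2 = 1 := by simp only [e2, map_mul, map_add, rx, r1, r2, ha1]; decide
  have q1 : A2.red e1 = 1 := by
    simp only [e1, map_mul, map_add, rx, r0, r1, r2, ha1, ha2, hb1]; decide
  have p1 : A2.red (y * z 4) = 1 := by simp only [map_mul, ry, r4]; decide
  have p2 : A2.red (y * z 5) = 0 := by simp only [map_mul, ry, r5]; decide
  have hcase : A2.red e0 = 0 ∨ A2.red e0 = 1 := by
    generalize A2.red e0 = s; revert s; decide
  rcases hcase with q0 | q0
  · exact ⟨e3, e2, e1, e0, _, _, _, hN, q3, q2, q1, q0, p1, p2⟩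
  · obtain ⟨h6, h5, h4, h3, h2, h1, h0⟩ := hN
    refine ⟨-e3, -e2, -e1, -1 - e0, (x * z 3) ^ 2, _, _, ⟨?_, ?_, ?_, ?_, ?_, ?_, ?_⟩, ?_, ?_, ?_, ?_, p1, p2⟩
    · linear_combination h6
    · linear_combination h5
    · linear_combination h4
    · linear_combination h3
    · linear_combination h2
    · linear_combination h1
    · linear_combination h0
    · rw [map_neg, q3]; decide
    · rw [map_neg, q2]; decide
    · rw [map_neg, q1]; decide
    · rw [map_sub, map_neg, map_one, q0]; decide

lemma inS_half {e3 e2 e1 e0 k a1 a2 c1 c2 : A2} (hN : Norm2 e3 e2 e1 e0 k a1 a2 c1 c2)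
    (q3 : A2.red e3 = 1) (q2 : A2.red e2 = 1) (q1 : A2.red e1 = 1)
    (p1 : A2.red c1 = 1) (p2 : A2.red c2 = 0) :
    ∃ b0 b1 w2 w1 w0 : A2, InS c1 c2 b0 b1 w2 w1 w0 := by
  obtain ⟨h6, h5, h4, h3, h2, h1, h0⟩ := hN
  obtain ⟨b1, hb1⟩ : ∃ b1, b1 = e3 * (c1 ^ 2 - c2) - e2 * c1 + e1 := ⟨_, rfl⟩
  obtain ⟨b0, hb0⟩ : ∃ b0, b0 = e3 * c1 * c2 - e2 * c2 + e0 := ⟨_, rfl⟩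
  refine ⟨b0, b1, -k * (a2 + a1 * c1 + c2) + e3 * (e1 + b1) + (e2 - e3 * c1) * e2,
    -k * (a1 * c2 + a2 * c1) + e3 * (e0 + b0 + 1) + (e2 - e3 * c1) * (e1 + b1),
    -k * a2 * c2 + (e2 - e3 * c1) * (e0 + b0 + 1), ?_, ?_, ?_, ?_, ?_, p1, p2, ?_⟩
  · subst hb1 hb0; linear_combination h4 - c1 * (h5 - c1 * h6) - c2 * h6
  · subst hb1 hb0; linear_combination h3 - c2 * (h5 - c1 * h6)
  · subst hb1 hb0; linear_combination h2
  · subst hb1 hb0; linear_combination h1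
  · subst hb1 hb0; linear_combination h0
  · subst hb1; simp only [map_add, map_sub, map_mul, map_pow, q3, q2, q1, p1, p2]; decide

lemma red_one_add {x : A2} (h : A2.red x = 1) : (2 : A2) ∣ x + 1 :=
  A2.two_dvd (by rw [map_add, h, map_one]; decide)

/-- The key uniqueness statement: `S` has only one element. -/
lemma inS_unique (H : HalfProp) {a1 a2 b0 b1 w2 w1 w0 : A2} (h : InS a1 a2 b0 b1 w2 w1 w0) :
    a1 = -1 ∧ a2 = 0 := by
  have key : ∀ m : ℕ, ∀ a1 a2 b0 b1 w2 w1 w0 : A2, InS a1 a2 b0 b1 w2 w1 w0 →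
      (2 : A2) ^ (m + 1) ∣ a1 + 1 ∧ (2 : A2) ^ (m + 1) ∣ a2 := by
    intro m
    induction m with
    | zero =>
      intro a1 a2 b0 b1 w2 w1 w0 h
      obtain ⟨-, -, -, -, -, ha1, ha2, -⟩ := h
      rw [zero_add, pow_one]
      exact ⟨red_one_add ha1, A2.two_dvd ha2⟩
    | succ m ih =>
      intro a1 a2 b0 b1 w2 w1 w0 h
      obtain ⟨⟨α1, hα1⟩, ⟨α2, hα2⟩⟩ := ih _ _ _ _ _ _ _ h
      obtain ⟨e3, e2, e1, e0, k, c1, c2, hN, q3, q2, q1, q0, p1, p2⟩ := base_step H h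
      obtain ⟨b0', b1', w2', w1', w0', hc⟩ := inS_half hN q3 q2 q1 p1 p2
      obtain ⟨⟨κ1, hκ1⟩, ⟨κ2, hκ2⟩⟩ := ih _ _ _ _ _ _ _ hc
      obtain ⟨d3, hd3⟩ := red_one_add q3
      obtain ⟨d0, hd0⟩ := A2.two_dvd q0
      obtain ⟨h6, h5, h4, h3, h2, h1, h0⟩ := hN
      have := contraction_aux A2.unit_odd ((2 : A2) ^ (m + 1)) ((2 : A2) ^ m) k e3 e2 e1 e0
        a1 a2 c1 c2 α1 α2 κ1 κ2 d0 d3 (pow_succ' _ _) h6 h5 h4 h3 h2 h1 h0 hα1 hα2 hκ1 hκ2 hd3 hd0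
      rwa [← pow_succ'] at this
  have hz : ∀ x : A2, (∀ m : ℕ, (2 : A2) ^ (m + 1) ∣ x) → x = 0 := fun x hx =>
    A2.eq_zero fun m => (pow_dvd_pow _ (Nat.le_succ m)).trans (hx m)
  have g1 := hz _ fun m => (key m _ _ _ _ _ _ _ h).1
  have g2 := hz _ fun m => (key m _ _ _ _ _ _ _ h).2
  exact ⟨eq_neg_of_add_eq_zero_left g1, g2⟩

lemma inv_mem_A2 {q : ℚ} (h : q ∉ A2) : q⁻¹ ∈ A2 := by
  rw [mem_A2] at h ⊢
  push_cast
  rw [norm_inv]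
  exact inv_le_one_of_one_le₀ (not_le.1 h).le

lemma mem_A2_of_quad {s β δ : ℚ} (hβ : β ∈ A2) (hδ : δ ∈ A2) (h : s ^ 2 + β * s + δ = 0) :
    s ∈ A2 := by
  by_contra hs
  have h0 : s ≠ 0 := by rintro rfl; exact hs A2.zero_mem
  have : s = -β - δ * s⁻¹ := by field_simp; linear_combination h
  apply hs
  rw [this]
  exact A2.sub_mem (A2.neg_mem hβ) (A2.mul_mem hδ (inv_mem_A2 hs))

lemma red_cases (x : A2) : A2.red x = 0 ∨ A2.red x = 1 := by
  generalize A2.red x = s; revert s; decide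

/-- Rational points with `2`-integral coordinates. -/
lemma pt_int (H : HalfProp) {X y : A2} (h : y ^ 2 + y = X ^ 5 - 2 * X ^ 3 + 2 * X ^ 2 - X) :
    X = 0 ∨ X = 1 := by
  obtain ⟨y1, hy1, hr⟩ : ∃ y1 : A2, y1 ^ 2 + y1 = 0 ∧ A2.red (y - y1) = 1 := by
    rcases red_cases y with hy | hy
    · exact ⟨-1, by ring, by rw [map_sub, hy, map_neg, map_one]; decide⟩
    · exact ⟨0, by ring, by rw [map_sub, hy, map_zero]; decide⟩
  rcases red_cases X with hX | hX
  · left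
    have hu : IsUnit (X - 1) := A2.isUnit (by rw [map_sub, hX, map_one]; decide)
    obtain ⟨i, hi⟩ := hu.exists_right_inv
    have ri : A2.red i = 1 := by
      have := congrArg A2.red hi
      rw [map_mul, map_sub, hX, map_one] at this
      generalize A2.red i = s at *; revert s; decide
    obtain ⟨b1, hb1⟩ : ∃ b1, b1 = (y - y1) * i := ⟨_, rfl⟩
    have hb : b1 * (X - 1) = y - y1 := by rw [hb1]; linear_combination (y - y1) * hi
    obtain ⟨w1, hw1⟩ : ∃ w1 : A2, w1 = -2 - (-(X + 1)) * (X + 1) - X := ⟨_, rfl⟩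
    obtain ⟨w0, hw0⟩ : ∃ w0 : A2, w0 = -(b1 ^ 2 - 2) - (-(X + 1)) * w1 - X * (X + 1) := ⟨_, rfl⟩
    have k1 : (2 * b1 * (y1 - b1) + b1 + 1 + (-(X + 1) * w0 + X * w1))
        + ((y1 - b1) ^ 2 + (y1 - b1) + X * w0) = 0 := by
      rw [hw0, hw1]; linear_combination hy1
    have kX : (2 * b1 * (y1 - b1) + b1 + 1 + (-(X + 1) * w0 + X * w1)) * X
        + ((y1 - b1) ^ 2 + (y1 - b1) + X * w0) = 0 := by
      rw [hw0, hw1]; linear_combination h + (b1 * (X - 1) + y + y1 + 1) * hb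
    have r1 : 2 * b1 * (y1 - b1) + b1 + 1 + (-(X + 1) * w0 + X * w1) = 0 := by
      linear_combination i * (kX - k1) - (2 * b1 * (y1 - b1) + b1 + 1 + (-(X + 1) * w0 + X * w1)) * hi
    have hS : InS (-(X + 1)) X (y1 - b1) b1 (X + 1) w1 w0 := by
      refine ⟨by ring, by rw [hw1]; ring, by rw [hw0]; ring, by linear_combination r1,
        by linear_combination k1 - r1, ?_, hX, ?_⟩
      · rw [map_neg, map_add, hX, map_one]; decide
      · rw [hb1, map_mul, hr, ri]; decide
    exact (inS_unique H hS).2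
  · right
    have hu : IsUnit X := A2.isUnit (by rw [hX]; decide)
    obtain ⟨i, hi⟩ := hu.exists_right_inv
    have ri : A2.red i = 1 := by
      have := congrArg A2.red hi
      rw [map_mul, hX, map_one, one_mul] at this
      exact this
    obtain ⟨b1, hb1⟩ : ∃ b1, b1 = (y - y1) * i := ⟨_, rfl⟩
    have hb : b1 * X = y - y1 := by rw [hb1]; linear_combination (y - y1) * hi
    obtain ⟨w1, hw1⟩ : ∃ w1 : A2, w1 = -2 + X * X := ⟨_, rfl⟩
    obtain ⟨w0, hw0⟩ : ∃ w0 : A2, w0 = -(b1 ^ 2 - 2) + X * w1 := ⟨_, rfl⟩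
    have kX : (2 * b1 * y1 + b1 + 1 + (-X * w0)) * X = 0 := by
      rw [hw0, hw1]; linear_combination h + (b1 * X + y + y1 + 1) * hb - hy1
    have r1 : 2 * b1 * y1 + b1 + 1 + (-X * w0) = 0 := by
      linear_combination i * kX - (2 * b1 * y1 + b1 + 1 + (-X * w0)) * hi
    have hS : InS (-X) 0 y1 b1 X w1 w0 := by
      refine ⟨by ring, by rw [hw1]; ring, by rw [hw0]; ring, by linear_combination r1,
        by linear_combination hy1, ?_, map_zero _, ?_⟩
      · rw [map_neg, hX]; decide
      · rw [hb1, map_mul, hr, ri]; decide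
    have := (inS_unique H hS).1
    exact neg_injective this

lemma pt_nonint (H : HalfProp) {X y : ℚ} (h : y ^ 2 + y = X ^ 5 - 2 * X ^ 3 + 2 * X ^ 2 - X)
    (hX : X ∉ A2) : False := by
  have hX0 : X ≠ 0 := by rintro rfl; exact hX A2.zero_mem
  have hX1 : X - 1 ≠ 0 := by
    intro h1; apply hX; rw [sub_eq_zero.1 h1]; exact A2.one_mem
  obtain ⟨u, hu⟩ : ∃ u : A2, (u : ℚ) = X⁻¹ := ⟨⟨_, inv_mem_A2 hX⟩, rfl⟩
  have huX : (u : ℚ) * X = 1 := by rw [hu]; exact inv_mul_cancel₀ hX0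
  have ru : A2.red u = 0 := by
    rcases red_cases u with h | h
    · exact h
    · exfalso
      obtain ⟨i, hi⟩ := (A2.isUnit (by rw [h]; decide) : IsUnit u).exists_right_inv
      apply hX
      have : (u : ℚ) * i = 1 := by exact_mod_cast congrArg (fun z : A2 => (z : ℚ)) hi
      have : X = i := by linear_combination X * (-this) + (i : ℚ) * huX
      rw [this]; exact i.2
  obtain ⟨l, hl⟩ : ∃ l : ℚ, l * (X * (X - 1)) = y + X :=
    ⟨(y + X) / (X * (X - 1)), div_mul_cancel₀ _ (mul_ne_zero hX0 hX1)⟩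
  have hR : l ^ 2 * (X ^ 2 - X) + l * (1 - 2 * X) - X ^ 3 - X ^ 2 + X = 0 := by
    have : (X * (X - 1)) * (l ^ 2 * (X ^ 2 - X) + l * (1 - 2 * X) - X ^ 3 - X ^ 2 + X) = 0 := by
      linear_combination h + (l * (X * (X - 1)) - X + y + 1) * hl
    exact (mul_eq_zero.1 this).resolve_left (mul_ne_zero hX0 hX1)
  -- the parameter `s = l / X`
  have hru : IsUnit (1 - u) := A2.isUnit (by rw [map_sub, ru, map_one]; decide)
  obtain ⟨r, hr⟩ := hru.exists_right_inv
  have hrQ : (1 - (u : ℚ)) * r = 1 := by exact_mod_cast congrArg (fun z : A2 => (z : ℚ)) hr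
  have rr : A2.red r = 1 := by
    have := congrArg A2.red hr
    rw [map_mul, map_sub, ru, map_one, sub_zero, one_mul] at this
    exact this
  have hsQ : (l * u) ^ 2 * (1 - u) + (l * u) * ((u : ℚ) ^ 3 - 2 * (u : ℚ) ^ 2)
      - u - (u : ℚ) ^ 2 + (u : ℚ) ^ 3 = 0 := by
    rw [hu]; field_simp; linear_combination hR
  have hsA : l * u ∈ A2 := by
    refine mem_A2_of_quad (β := ((r * (u ^ 3 - 2 * u ^ 2) : A2) : ℚ))
      (δ := ((r * (-u - u ^ 2 + u ^ 3) : A2) : ℚ)) (Subtype.mem _) (Subtype.mem _) ?_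
    have h2 : ((2 : A2) : ℚ) = 2 := rfl
    push_cast
    rw [h2]
    linear_combination (r : ℚ) * hsQ - (l * u) ^ 2 * hrQ
  obtain ⟨s, hs⟩ : ∃ s : A2, (s : ℚ) = l * u := ⟨⟨_, hsA⟩, rfl⟩
  have hsE : s ^ 2 * (1 - u) + s * (u ^ 3 - 2 * u ^ 2) - u - u ^ 2 + u ^ 3 = 0 := by
    apply Subtype.ext
    have h2 : ((2 : A2) : ℚ) = 2 := rfl
    push_cast
    rw [h2, hs]; exact hsQ
  have rs : A2.red s = 0 := by
    have := congrArg A2.red hsE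
    simp only [map_add, map_sub, map_mul, map_pow, map_one, map_ofNat, ru, map_zero] at this
    generalize A2.red s = z at *; revert z; decide
  obtain ⟨v, hv⟩ : ∃ v : A2, v = (1 + u - u ^ 2 - s * u * (u - 2)) * r := ⟨_, rfl⟩
  have hsv : s ^ 2 = u * v := by
    rw [hv]; linear_combination r * hsE - s ^ 2 * hr
  have rv : A2.red v = 1 := by
    rw [hv]
    simp only [map_add, map_sub, map_mul, map_pow, map_one, map_ofNat, ru, rs, rr]; decide
  obtain ⟨a1, ha1⟩ : ∃ a1 : A2, a1 = -v + s * u - 2 * s + u := ⟨_, rfl⟩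
  obtain ⟨b1, hb1⟩ : ∃ b1 : A2, b1 = -1 - s * ((-2 + u + s * u - 2 * s) * r + s + 1) + 2 * v :=
    ⟨_, rfl⟩
  have hlX : (s : ℚ) * X = l := by rw [hs]; linear_combination l * huX
  have hvQ : (v : ℚ) = l * s := by
    have h1 : (s : ℚ) ^ 2 = u * v := by exact_mod_cast congrArg (fun z : A2 => (z : ℚ)) hsv
    linear_combination (-X) * h1 + s * hlX - (v : ℚ) * huX
  have hvr : v * (1 - u) = 1 + u - u ^ 2 - s * u * (u - 2) := by
    rw [hv]; linear_combination (1 + u - u ^ 2 - s * u * (u - 2)) * hr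
  have hvrQ : (v : ℚ) * (1 - u) = 1 + u - u ^ 2 - s * u * (u - 2) := by
    have := congrArg (fun z : A2 => (z : ℚ)) hvr
    have h2 : ((2 : A2) : ℚ) = 2 := rfl
    push_cast at this
    rw [h2] at this
    exact this
  have ha1Q : (a1 : ℚ) = 1 + X - l ^ 2 := by
    have h2 : ((2 : A2) : ℚ) = 2 := rfl
    rw [ha1]; push_cast; rw [h2, hvQ]
    rw [hvQ] at hvrQ
    linear_combination X * hvrQ - l * hlX + (l * s + 1 - u - s * u + 2 * s) * huX
  have h3 : (s : ℚ) - X * a1 = l ^ 2 + 2 * l - 1 := by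
    rw [ha1Q, hs, hu]; field_simp; linear_combination hR
  have hb1Q : (b1 : ℚ) = -(1 + l) - l * a1 := by
    have h2 : ((2 : A2) : ℚ) = 2 := rfl
    have hv1 : 1 - (v : ℚ) = u * (-2 + u + s * u - 2 * s) * r := by
      linear_combination (-(1 - (v : ℚ))) * hrQ - r * hvrQ
    rw [hb1, ha1]; push_cast; rw [h2]
    linear_combination l * hv1 - ((-2 + u + s * u - 2 * s) * r + s + 1) * hs + 2 * hvQ
  have hw1 : (-2 + (a1 : ℚ) ^ 2 - s) = X + l * (b1 - 1 - l) := by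
    rw [hb1Q]; linear_combination -h3 + (1 + a1) * ha1Q
  have hw0 : -((b1 : ℚ) ^ 2 - 2) - a1 * (-2 + (a1 : ℚ) ^ 2 - s) + s * a1 = l * (-v + 1) := by
    rw [hb1Q] at hw1 ⊢; rw [hvQ]; linear_combination h3 + hlX - a1 * hw1 + s * ha1Q
  have hS : InS a1 s (-v) b1 (-a1) (-2 + a1 ^ 2 - s)
      (-(b1 ^ 2 - 2) - a1 * (-2 + a1 ^ 2 - s) + s * a1) := by
    have h2 : ((2 : A2) : ℚ) = 2 := rfl
    refine ⟨by ring, by ring, by ring, ?_, ?_, ?_, rs, ?_⟩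
    · apply Subtype.ext; push_cast; rw [h2]; rw [hb1Q, hvQ] at *; linear_combination hlX + a1 * hw0 + s * hw1
    · apply Subtype.ext; push_cast; rw [h2]; rw [hvQ] at *; linear_combination s * hw0
    · rw [ha1]
      simp only [map_add, map_sub, map_neg, map_mul, map_ofNat, ru, rs, rv]; decide
    · rw [hb1]
      simp only [map_add, map_sub, map_neg, map_mul, map_one, map_ofNat, ru, rs, rv, rr]; decide
  have hs0 := (inS_unique H hS).2
  rw [hs0] at hsE
  have hun : IsUnit (1 + u - u ^ 2) := A2.isUnit (by
    rw [map_sub, map_add, map_pow, ru, map_one]; decide)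
  have hu0 : u = 0 := (hun.mul_left_eq_zero).1 (by linear_combination -hsE)
  rw [hu0] at huX
  simp at huX

theorem final (H : HalfProp) :
    {p : ℚ × ℚ |
        p.2 ^ 2 = p.1 ^ 6 - 2 * p.1 ^ 5 + 3 * p.1 ^ 4 - 4 * p.1 ^ 3 -
          p.1 ^ 2 + 2 * p.1 + 1} =
      ({(0, 1), (0, -1), (1, 0)} : Set (ℚ × ℚ)) := by
  ext ⟨x, y⟩
  simp only [Set.mem_ofPred_eq, Set.mem_insert_iff, Set.mem_singleton_iff, Prod.mk.injEq]
  constructor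
  · intro h
    by_cases hx : x = 1
    · subst hx
      right; right
      exact ⟨rfl, by have : y ^ 2 = 0 := by linear_combination h
                     exact pow_eq_zero_iff (two_ne_zero) |>.1 this⟩
    · have hx' : 1 - x ≠ 0 := sub_ne_zero.2 (Ne.symm hx)
      obtain ⟨X, hX⟩ : ∃ X : ℚ, X * (1 - x) = 1 := ⟨(1 - x)⁻¹, inv_mul_cancel₀ hx'⟩
      have hxX : X = (1 - x)⁻¹ := eq_inv_of_mul_eq_one_left hX
      have hc : ((y * X ^ 3 - 1) / 2) ^ 2 + (y * X ^ 3 - 1) / 2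
          = X ^ 5 - 2 * X ^ 3 + 2 * X ^ 2 - X := by
        rw [hxX]; field_simp; linear_combination h
      have hXA : X ∈ A2 := by
        by_contra hn; exact pt_nonint H hc hn
      have hyA : (y * X ^ 3 - 1) / 2 ∈ A2 := by
        refine mem_A2_of_quad (β := 1) (δ := -(X ^ 5 - 2 * X ^ 3 + 2 * X ^ 2 - X)) A2.one_mem ?_
          (by linear_combination hc)
        have h2 : (2 : ℚ) ∈ A2 := (2 : A2).2
        exact A2.neg_mem (A2.sub_mem (A2.add_mem (A2.sub_mem (A2.pow_mem hXA _)
          (A2.mul_mem h2 (A2.pow_mem hXA _))) (A2.mul_mem h2 (A2.pow_mem hXA _))) hXA)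
      have := pt_int H (X := ⟨X, hXA⟩) (y := ⟨_, hyA⟩) (Subtype.ext hc)
      have hX1 : X = 1 := by
        rcases this with h | h
        · have : X = 0 := congrArg (fun z : A2 => (z : ℚ)) h
          rw [this] at hX; simp at hX
        · exact congrArg (fun z : A2 => (z : ℚ)) h
      have hx0 : x = 0 := by rw [hX1] at hX; linear_combination -hX
      subst hx0
      have hy : (y - 1) * (y + 1) = 0 := by linear_combination h
      rcases mul_eq_zero.1 hy with h | h
      · left; exact ⟨rfl, by linear_combination h⟩
      · right; left; exact ⟨rfl, by linear_combination h⟩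
  · rintro (⟨rfl, rfl⟩ | ⟨rfl, rfl⟩ | ⟨rfl, rfl⟩) <;> norm_num

section
open Polynomial NumberField

/-- The Eisenstein quintic. -/
noncomputable def qE : ℤ[X] := X ^ 5 + 6 * X ^ 4 + 10 * X ^ 3 + 4 * X ^ 2 + 2

lemma qE_natDegree : qE.natDegree = 5 := by unfold qE; compute_degree!
lemma qE_monic : qE.Monic := by unfold qE; monicity!
lemma qE_coeff : ∀ i < 5, qE.coeff i = ![2, 0, 4, 10, 6] (Fin.ofNat 5 i) := by
  intro i hi
  have h6 : (6 : ℤ[X]) = C 6 := rfl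
  have h10 : (10 : ℤ[X]) = C 10 := rfl
  have h4 : (4 : ℤ[X]) = C 4 := rfl
  have h2 : (2 : ℤ[X]) = C 2 := rfl
  unfold qE
  rw [h6, h10, h4, h2]
  interval_cases i <;> simp [coeff_X_pow] <;> rfl

lemma qE_eisenstein : qE.IsEisensteinAt (Submodule.span ℤ {(2 : ℤ)}) := by
  refine ⟨?_, ?_, ?_⟩
  · rw [qE_monic.leadingCoeff]
    intro h
    have := Ideal.mem_span_singleton.mp h
    norm_num at this
  · intro n hn
    rw [qE_natDegree] at hn
    rw [qE_coeff n hn]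
    refine Ideal.mem_span_singleton.mpr ?_
    interval_cases n <;> decide
  · rw [qE_coeff 0 (by norm_num)]
    intro h
    rw [← Ideal.span, Ideal.span_singleton_pow, Ideal.mem_span_singleton] at h
    revert h; decide

lemma qE_irreducible : Irreducible qE := by
  refine qE_eisenstein.irreducible ?_ qE_monic.isPrimitive (by rw [qE_natDegree]; norm_num)
  exact (Ideal.span_singleton_prime (by norm_num)).mpr Int.prime_two

lemma qEQ_irreducible : Irreducible (qE.map (algebraMap ℤ ℚ)) :=
  (qE_monic.irreducible_iff_irreducible_map_fraction_map).mp qE_irreducible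

section
variable {K : Type*} [Field K] [NumberField K]

lemma minpoly_of_root {x : K} (hx : aeval x qE = 0) :
    minpoly ℚ x = qE.map (algebraMap ℤ ℚ) := by
  refine (minpoly.eq_of_irreducible_of_monic qEQ_irreducible ?_ (qE_monic.map _)).symm
  rw [aeval_map_algebraMap]; exact hx

lemma minpolyZ_of_root {x : K} (hx : aeval x qE = 0) : minpoly ℤ x = qE := by
  have hi : IsIntegral ℤ x := ⟨qE, qE_monic, hx⟩
  have h := minpoly.isIntegrallyClosed_eq_field_fractions' ℚ hi
  rw [minpoly_of_root hx] at h
  exact (Polynomial.map_injective _ (RingHom.injective_int _) h).symm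

lemma root_eq {A : Type*} [CommRing A] {x : A} (hx : aeval x qE = 0) :
    x ^ 5 + 6 * x ^ 4 + 10 * x ^ 3 + 4 * x ^ 2 + 2 = 0 := by
  rw [← hx]
  unfold qE
  simp only [map_add, map_mul, map_pow, aeval_X]
  rw [map_ofNat (aeval x) 6, map_ofNat (aeval x) 10, map_ofNat (aeval x) 4, map_ofNat (aeval x) 2]

/-- companion matrix -/
def compM : Matrix (Fin 5) (Fin 5) ℚ :=
  !![0,0,0,0,-2; 1,0,0,0,0; 0,1,0,0,-4; 0,0,1,0,-10; 0,0,0,1,-6]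

lemma leftMul_eq (b : Module.Basis (Fin 5) ℚ K) {x : K} (hx : aeval x qE = 0)
    (hb : ∀ i, b i = x ^ (i : ℕ)) : Algebra.leftMulMatrix b x = compM := by
  have h5 : x ^ 5 = -2 - 4 * x ^ 2 - 10 * x ^ 3 - 6 * x ^ 4 := by
    linear_combination root_eq hx
  rw [Algebra.leftMulMatrix_apply, ← LinearEquiv.eq_symm_apply, LinearMap.toMatrix_symm]
  refine b.ext fun k => ?_
  rw [Matrix.toLin_self]
  simp only [hb, Fin.sum_univ_five, compM]
  fin_cases k <;> simp [Algebra.smul_def] <;> (try ring_nf)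
  linear_combination h5

lemma norm_deriv (b : Module.Basis (Fin 5) ℚ K) {x : K} (hx : aeval x qE = 0)
    (hb : ∀ i, b i = x ^ (i : ℕ)) :
    Algebra.norm ℚ (5 * x ^ 4 + 24 * x ^ 3 + 30 * x ^ 2 + 8 * x) = 4432 := by
  have : Algebra.leftMulMatrix b (5 * x ^ 4 + 24 * x ^ 3 + 30 * x ^ 2 + 8 * x) =
     (5:ℚ) • compM ^ 4 + (24:ℚ) • compM ^ 3 + (30:ℚ) • compM ^ 2 + (8:ℚ) • compM := by
    rw [← leftMul_eq b hx hb]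
    simp only [← map_pow, ← map_smul, ← map_add]
    congr 1
    simp [Algebra.smul_def]
  rw [Algebra.norm_eq_matrix_det b, this]
  have e2 : compM ^ 2 = !![0,0,0,-2,12; 0,0,0,0,-2; 1,0,0,-4,24; 0,1,0,-10,56; 0,0,1,-6,26] := by
    rw [pow_two]
    ext i j; fin_cases i <;> fin_cases j <;>
      simp [compM, Matrix.mul_apply, Fin.sum_univ_five] <;> norm_num
  have e3 : compM ^ 3 = !![0, 0, -2, 12, -52; 0, 0, 0, -2, 12; 0, 0, -4, 24, -106;
      1, 0, -10, 56, -236; 0, 1, -6, 26, -100] := by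
    rw [pow_succ, e2]
    ext i j; fin_cases i <;> fin_cases j <;>
      simp [compM, Matrix.mul_apply, Fin.sum_univ_five] <;> norm_num
  have e4 : compM ^ 4 = !![0, -2, 12, -52, 200; 0, 0, -2, 12, -52; 0, -4, 24, -106, 412;
      0, -10, 56, -236, 894; 1, -6, 26, -100, 364] := by
    rw [pow_succ, e3]
    ext i j; fin_cases i <;> fin_cases j <;>
      simp [compM, Matrix.mul_apply, Fin.sum_univ_five] <;> norm_num
  have e : (5:ℚ) • compM ^ 4 + (24:ℚ) • compM ^ 3 + (30:ℚ) • compM ^ 2 + (8:ℚ) • compM =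
      !![0, -10, 12, -32, 96; 8, 0, -10, 12, -32; 30, -12, 24, -74, 204;
        24, -20, 48, -136, 406; 5, -6, 16, -48, 152] := by
    rw [e4, e3, e2]
    ext i j; fin_cases i <;> fin_cases j <;> simp [compM] <;> norm_num
  rw [e]
  simp [Matrix.det_succ_row_zero, Fin.sum_univ_succ, Fin.succAbove]
  norm_num

lemma exists_basis (hd : Module.finrank ℚ K = 5) {x : K} (hx : aeval x qE = 0) :
    ∃ B : PowerBasis ℚ K, B.gen = x ∧ B.dim = 5 := by
  have hdeg : (minpoly ℚ x).natDegree = 5 := by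
    rw [minpoly_of_root hx, qE_monic.natDegree_map, qE_natDegree]
  have hi : IsIntegral ℚ x := Algebra.IsIntegral.isIntegral x
  have htop : Algebra.adjoin ℚ {x} = ⊤ := by
    rw [← Algebra.toSubmodule_eq_top]
    apply Submodule.eq_top_of_finrank_eq
    rw [hd]
    have := (Algebra.adjoin.powerBasis hi).finrank
    rw [Algebra.adjoin.powerBasis_dim, hdeg] at this
    exact this
  refine ⟨PowerBasis.ofAdjoinEqTop hi htop, PowerBasis.ofAdjoinEqTop_gen .., ?_⟩
  rw [PowerBasis.ofAdjoinEqTop_dim, hdeg]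

lemma discr_pow (B : PowerBasis ℚ K) (h5 : B.dim = 5) (hx : aeval B.gen qE = 0) :
    Algebra.discr ℚ (B.basis.reindex (finCongr h5)) = 4432 := by
  have hn := norm_deriv (B.basis.reindex (finCongr h5)) hx (by intro i; simp)
  rw [Module.Basis.coe_reindex, Algebra.discr_reindex, Algebra.discr_powerBasis_eq_norm,
    minpoly_of_root hx, B.finrank, h5]
  have hder : aeval B.gen (derivative (qE.map (algebraMap ℤ ℚ))) =
      5 * B.gen ^ 4 + 24 * B.gen ^ 3 + 30 * B.gen ^ 2 + 8 * B.gen := by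
    have hq : derivative qE = 5 * X ^ 4 + 24 * X ^ 3 + 30 * X ^ 2 + 8 * X := by
      unfold qE
      simp
      ring
    rw [derivative_map, aeval_map_algebraMap, hq]
    simp only [map_add, map_mul, map_pow, aeval_X]
    rw [map_ofNat (aeval B.gen) 5, map_ofNat (aeval B.gen) 24, map_ofNat (aeval B.gen) 30,
      map_ofNat (aeval B.gen) 8]
  rw [hder, hn]
  norm_num

end
end

section
open Polynomial NumberField
section
variable {K : Type*} [Field K] [NumberField K]

lemma index_aux (hd : Module.finrank ℚ K = 5) {r : 𝓞 K} (hx : aeval (r : K) qE = 0) :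
    ∃ d : ℤ, d ^ 2 * NumberField.discr K = 4432 ∧
      ∀ z : 𝓞 K, d • z ∈ Algebra.adjoin ℤ {r} := by
  obtain ⟨B, hB, h5⟩ := exists_basis hd hx
  have hcard : Fintype.card (Module.Free.ChooseBasisIndex ℤ (𝓞 K)) = 5 := by
    rw [← Module.finrank_eq_card_chooseBasisIndex, RingOfIntegers.rank, hd]
  let e : Module.Free.ChooseBasisIndex ℤ (𝓞 K) ≃ Fin 5 := Fintype.equivFinOfCardEq hcard
  let bZ : Module.Basis (Fin 5) ℤ (𝓞 K) := (RingOfIntegers.basis K).reindex e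
  let bQ : Module.Basis (Fin 5) ℚ K := (integralBasis K).reindex e
  have hbQ : ∀ i, bQ i = (bZ i : K) := by
    intro i; simp [bQ, bZ]
  let P : Matrix (Fin 5) (Fin 5) ℤ := fun i j => bZ.repr (r ^ (j : ℕ)) i
  have hP : ∀ j : Fin 5, r ^ (j : ℕ) = ∑ i, P i j • bZ i := fun j => (bZ.sum_repr _).symm
  refine ⟨P.det, ?_, ?_⟩
  · have hdis : Algebra.discr ℚ bQ = (NumberField.discr K : ℚ) := by
      rw [coe_discr, Module.Basis.coe_reindex, Algebra.discr_reindex]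
    have hv : (⇑(B.basis.reindex (finCongr h5)) : Fin 5 → K) =
        Matrix.vecMul bQ ((P.map (Int.castRingHom ℚ)).map (algebraMap ℚ K)) := by
      funext j
      simp only [Matrix.vecMul, dotProduct, hbQ]
      have := congrArg (algebraMap (𝓞 K) K) (hP j)
      rw [map_sum, map_pow] at this
      simp only [Module.Basis.coe_reindex, Function.comp, B.basis_eq_pow, hB]
      simp only [zsmul_eq_mul, map_mul, map_intCast] at this
      simpa [mul_comm] using this
    have h1 := discr_pow B h5 (by rw [hB]; exact hx)
    rw [hv, Algebra.discr_of_matrix_vecMul, hdis] at h1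
    have h2 : (P.map (Int.castRingHom ℚ)).det = ((P.det : ℤ) : ℚ) := by
      have := (RingHom.map_det (Int.castRingHom ℚ) P).symm
      simpa [RingHom.mapMatrix_apply] using this
    rw [h2] at h1
    exact_mod_cast h1
  · have hb : ∀ i, P.det • bZ i ∈ Algebra.adjoin ℤ {r} := by
      intro i
      have : P.det • bZ i = ∑ j, P.adjugate j i • r ^ (j : ℕ) := by
        simp only [hP, Finset.smul_sum, smul_smul]
        rw [Finset.sum_comm]
        simp only [← Finset.sum_smul]
        have hm := Matrix.mul_adjugate P
        have : ∀ k, ∑ j, P.adjugate j i * P k j = (P.det • (1 : Matrix (Fin 5) (Fin 5) ℤ)) k i := by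
          intro k; rw [← hm, Matrix.mul_apply]; simp [mul_comm]
        simp only [this, Matrix.smul_apply, Matrix.one_apply]
        simp
      rw [this]
      exact Subalgebra.sum_mem _ fun j _ => Subalgebra.smul_mem _
        (Subalgebra.pow_mem _ (Algebra.self_mem_adjoin_singleton ℤ r) _) _
    intro z
    rw [← bZ.sum_repr z, Finset.smul_sum]
    refine Subalgebra.sum_mem _ fun j _ => ?_
    rw [smul_comm]
    exact Subalgebra.smul_mem _ (hb j) _

lemma discr_le (hd : Module.finrank ℚ K = 5) {r : 𝓞 K} (hx : aeval (r : K) qE = 0) :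
    |NumberField.discr K| ≤ 4432 := by
  obtain ⟨d, h, -⟩ := index_aux hd hx
  have hd1 : 1 ≤ d ^ 2 := by
    by_contra hc
    have : d ^ 2 = 0 := le_antisymm (by omega) (sq_nonneg d)
    rw [this] at h; norm_num at h
  rw [abs_le]
  constructor <;> nlinarith [sq_nonneg d]

lemma mem_adjoin (hd : Module.finrank ℚ K = 5) {r : 𝓞 K} (hx : aeval (r : K) qE = 0) (z : 𝓞 K) :
    z ∈ Algebra.adjoin ℤ {r} := by
  obtain ⟨d, h, hz⟩ := index_aux hd hx
  have h4 : d ∣ 2 ^ 2 := by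
    have hdv : d.natAbs ^ 2 ∣ 4432 := by
      have : d ^ 2 ∣ 4432 := ⟨_, h.symm⟩
      have := Int.natAbs_dvd_natAbs.mpr this
      simpa [Int.natAbs_pow] using this
    have hle : d.natAbs ≤ 66 := by
      by_contra hc
      have := Nat.le_of_dvd (by norm_num) hdv
      nlinarith
    rw [← Int.natAbs_dvd_natAbs]
    generalize d.natAbs = n at *
    clear hz h
    interval_cases n <;> revert hdv <;> decide
  have hz4 : (2:ℤ) ^ 2 • z ∈ Algebra.adjoin ℤ {r} := by
    obtain ⟨c, hc⟩ := h4
    rw [hc, mul_comm, mul_smul]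
    exact Subalgebra.smul_mem _ (hz z) _
  obtain ⟨B, hB, h5⟩ := exists_basis hd hx
  have hmap : (Algebra.adjoin ℤ {r}).map (Algebra.algHom ℤ (𝓞 K) K) = Algebra.adjoin ℤ {B.gen} := by
    rw [AlgHom.map_adjoin_singleton, hB]; rfl
  have key : (z : K) ∈ Algebra.adjoin ℤ {B.gen} := by
    refine mem_adjoin_of_smul_prime_pow_smul_of_minpoly_isEisensteinAt (p := (2:ℤ)) (n := 2) 
      Int.prime_two ?_ (RingOfIntegers.isIntegral_coe z) ?_ ?_
    · rw [hB]; exact RingOfIntegers.isIntegral_coe r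
    · rw [← hmap]
      refine ⟨_, hz4, ?_⟩
      rw [RingHom.coe_coe, map_zsmul]; rfl
    · rw [hB, minpolyZ_of_root hx]; exact qE_eisenstein
  rw [← hmap] at key
  obtain ⟨y, hy, hyz⟩ := key
  have : y = z := RingOfIntegers.ext hyz
  rw [← this]; exact hy

lemma root_eqO {r : 𝓞 K} (hx : aeval (r : K) qE = 0) :
    r ^ 5 + 6 * r ^ 4 + 10 * r ^ 3 + 4 * r ^ 2 + 2 = 0 := by
  apply RingOfIntegers.ext
  have := root_eq hx
  simp only [map_add, map_mul, map_pow, map_zero]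
  rw [map_ofNat (algebraMap (𝓞 K) K) 6, map_ofNat (algebraMap (𝓞 K) K) 10,
    map_ofNat (algebraMap (𝓞 K) K) 4, map_ofNat (algebraMap (𝓞 K) K) 2]
  exact this

lemma exists_coords (hd : Module.finrank ℚ K = 5) {r : 𝓞 K} (hx : aeval (r : K) qE = 0) (z : 𝓞 K) :
    ∃ x0 x1 x2 x3 x4 : ℤ, z = x0 + x1 * r + x2 * r ^ 2 + x3 * r ^ 3 + x4 * r ^ 4 := by
  have hr := root_eqO hx
  induction mem_adjoin hd hx z using Algebra.adjoin_induction with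
  | mem y hy => 
    rw [Set.mem_singleton_iff] at hy
    exact ⟨0, 1, 0, 0, 0, by simp [hy]⟩
  | algebraMap n => exact ⟨n, 0, 0, 0, 0, by simp⟩
  | add a b _ _ ha hb =>
    obtain ⟨a0, a1, a2, a3, a4, rfl⟩ := ha
    obtain ⟨b0, b1, b2, b3, b4, rfl⟩ := hb
    exact ⟨a0 + b0, a1 + b1, a2 + b2, a3 + b3, a4 + b4, by push_cast; ring⟩
  | mul a b _ _ ha hb =>
    obtain ⟨a0, a1, a2, a3, a4, rfl⟩ := ha
    obtain ⟨b0, b1, b2, b3, b4, rfl⟩ := hb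
    have h5 : r ^ 5 = (-2) * r ^ 0 + (0) * r ^ 1 + (-4) * r ^ 2 + (-10) * r ^ 3 + (-6) * r ^ 4 := by linear_combination hr
    have h6 : r ^ 6 = (12) * r ^ 0 + (-2) * r ^ 1 + (24) * r ^ 2 + (56) * r ^ 3 + (26) * r ^ 4 := by linear_combination r * h5 + (-6) * h5
    have h7 : r ^ 7 = (-52) * r ^ 0 + (12) * r ^ 1 + (-106) * r ^ 2 + (-236) * r ^ 3 + (-100) * r ^ 4 := by linear_combination r * h6 + 26 * h5
    have h8 : r ^ 8 = (200) * r ^ 0 + (-52) * r ^ 1 + (412) * r ^ 2 + (894) * r ^ 3 + (364) * r ^ 4 := by linear_combination r * h7 + (-100) * h5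
    refine ⟨(a0 * b0) + (-2) * (a1 * b4 + a2 * b3 + a3 * b2 + a4 * b1) + (12) * (a2 * b4 + a3 * b3 + a4 * b2) + (-52) * (a3 * b4 + a4 * b3) + (200) * (a4 * b4),
      (a0 * b1 + a1 * b0) + (0) * (a1 * b4 + a2 * b3 + a3 * b2 + a4 * b1) + (-2) * (a2 * b4 + a3 * b3 + a4 * b2) + (12) * (a3 * b4 + a4 * b3) + (-52) * (a4 * b4),
      (a0 * b2 + a1 * b1 + a2 * b0) + (-4) * (a1 * b4 + a2 * b3 + a3 * b2 + a4 * b1) + (24) * (a2 * b4 + a3 * b3 + a4 * b2) + (-106) * (a3 * b4 + a4 * b3) + (412) * (a4 * b4),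
      (a0 * b3 + a1 * b2 + a2 * b1 + a3 * b0) + (-10) * (a1 * b4 + a2 * b3 + a3 * b2 + a4 * b1) + (56) * (a2 * b4 + a3 * b3 + a4 * b2) + (-236) * (a3 * b4 + a4 * b3) + (894) * (a4 * b4),
      (a0 * b4 + a1 * b3 + a2 * b2 + a3 * b1 + a4 * b0) + (-6) * (a1 * b4 + a2 * b3 + a3 * b2 + a4 * b1) + (26) * (a2 * b4 + a3 * b3 + a4 * b2) + (-100) * (a3 * b4 + a4 * b3) + (364) * (a4 * b4), ?_⟩
    push_cast
    linear_combination (a1 * b4 + a2 * b3 + a3 * b2 + a4 * b1) * h5 + (a2 * b4 + a3 * b3 + a4 * b2) * h6 + (a3 * b4 + a4 * b3) * h7 + (a4 * b4) * h8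
end
end

section
open Polynomial NumberField
section
variable {K : Type*} [Field K] [NumberField K]

lemma minkowski_lt (hd : Module.finrank ℚ K = 5) {r : 𝓞 K} (hx : aeval (r : K) qE = 0) :
    ((4 / Real.pi) ^ InfinitePlace.nrComplexPlaces K *
      ((Module.finrank ℚ K).factorial / (Module.finrank ℚ K : ℝ) ^ (Module.finrank ℚ K) * √|NumberField.discr K|)) < 5 := by
  have hc := InfinitePlace.card_add_two_mul_card_eq_rank K
  rw [hd] at hc
  have hc2 : InfinitePlace.nrComplexPlaces K ≤ 2 := by omega
  have hpi := Real.pi_gt_d2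
  have h1 : (1:ℝ) ≤ 4 / Real.pi := by
    rw [le_div_iff₀ Real.pi_pos, one_mul]; exact Real.pi_le_four
  have h2 : 4 / Real.pi ≤ 1.28 := by
    rw [div_le_iff₀ Real.pi_pos]; nlinarith
  have h3 : (4 / Real.pi) ^ InfinitePlace.nrComplexPlaces K ≤ 1.28 ^ 2 :=
    (pow_le_pow_right₀ h1 hc2).trans (pow_le_pow_left₀ (by linarith) h2 2)
  have h4 : √|(NumberField.discr K : ℝ)| ≤ 67 := by
    rw [Real.sqrt_le_left (by norm_num)]
    have := discr_le hd hx
    have : (|(NumberField.discr K : ℝ)|) ≤ 4432 := by exact_mod_cast this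
    linarith
  rw [hd]
  have h5 : ((Nat.factorial 5 : ℕ) : ℝ) / ((5 : ℕ) : ℝ) ^ 5 = 120 / 3125 := by
    norm_num [Nat.factorial]
  rw [h5]
  have h0 : 0 ≤ √|(NumberField.discr K : ℝ)| := Real.sqrt_nonneg _
  calc _ ≤ (1.28:ℝ) ^ 2 * (120 / 3125 * 67) := by gcongr
    _ < 5 := by norm_num

lemma isPID (hd : Module.finrank ℚ K = 5) {r : 𝓞 K} (hx : aeval (r : K) qE = 0) :
    IsPrincipalIdealRing (𝓞 K) := by
  have hr := root_eqO hx
  apply RingOfIntegers.isPrincipalIdealRing_of_isPrincipal_of_norm_le_of_isPrime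
  rintro ⟨I, hI⟩ hp hn
  have hlt := hn.trans_lt (minkowski_lt hd hx)
  simp only at hp hlt
  have hn5 : Ideal.absNorm I < 5 := by exact_mod_cast hlt
  have hI0 : I ≠ ⊥ := nonZeroDivisors.ne_zero hI
  have h0 : Ideal.absNorm I ≠ 0 := by rw [Ne, Ideal.absNorm_eq_zero_iff]; exact hI0
  have h1 : Ideal.absNorm I ≠ 1 := by rw [Ne, Ideal.absNorm_eq_one_iff]; exact hp.ne_top
  have hmem := Ideal.absNorm_mem I
  have one_not : (1 : 𝓞 K) ∉ I := fun h => hp.ne_top ((Ideal.eq_top_iff_one I).mpr h)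
  have h2case : (2 : 𝓞 K) ∈ I → Submodule.IsPrincipal I := by
    intro h2
    have hrI : r ∈ I := by
      apply hp.mem_of_pow_mem 5
      have : r ^ 5 = 2 * (- 3 * r ^ 4 - 5 * r ^ 3 - 2 * r ^ 2 - 1) := by linear_combination hr
      rw [this]; exact I.mul_mem_right _ h2
    have h2r : (2 : 𝓞 K) = r * (- r ^ 4 - 6 * r ^ 3 - 10 * r ^ 2 - 4 * r) := by
      linear_combination hr
    refine ⟨r, le_antisymm ?_ ?_⟩
    · intro z hz
      obtain ⟨x0, x1, x2, x3, x4, rfl⟩ := exists_coords hd hx z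
      change _ ∈ Ideal.span {r}
      rw [Ideal.mem_span_singleton]
      have hx0 : (x0 : 𝓞 K) ∈ I := by
        have : (x0 : 𝓞 K) = (x0 + x1 * r + x2 * r ^ 2 + x3 * r ^ 3 + x4 * r ^ 4) -
          (x1 + x2 * r + x3 * r ^ 2 + x4 * r ^ 3) * r := by ring
        rw [this]
        exact I.sub_mem hz (I.mul_mem_left _ hrI)
      rcases Int.even_or_odd' x0 with ⟨k, hk | hk⟩
      · refine ⟨(- r ^ 4 - 6 * r ^ 3 - 10 * r ^ 2 - 4 * r) * k + x1 + x2 * r + x3 * r ^ 2 + x4 * r ^ 3, ?_⟩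
        rw [hk]; push_cast
        linear_combination k * h2r
      · exfalso; apply one_not
        have : (1 : 𝓞 K) = x0 - 2 * k := by rw [hk]; push_cast; ring
        rw [this]
        exact I.sub_mem hx0 (I.mul_mem_right _ h2)
    · change Ideal.span {r} ≤ I
      rw [Ideal.span_singleton_le_iff_mem]; exact hrI
  have hcases : Ideal.absNorm I = 2 ∨ Ideal.absNorm I = 3 ∨ Ideal.absNorm I = 4 := by omega
  rcases hcases with h | h | h
  · rw [h] at hmem; exact h2case (by exact_mod_cast hmem)
  · exfalso
    have hmax : I.IsMaximal := hp.isMaximal hI0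
    let := Ideal.Quotient.field I
    rw [Ideal.absNorm_apply, Submodule.cardQuot_apply] at h
    have : Finite (𝓞 K ⧸ I) := Nat.finite_of_card_ne_zero (by rw [h]; norm_num)
    have := Fintype.ofFinite (𝓞 K ⧸ I)
    rw [Nat.card_eq_fintype_card] at h
    set g : 𝓞 K ⧸ I := Ideal.Quotient.mk I r with hg
    have hg3 := FiniteField.pow_card g
    rw [h] at hg3
    have h3 : (3 : 𝓞 K ⧸ I) = 0 := by
      have := Ideal.Quotient.eq_zero_iff_mem.mpr hmem
      rw [Ideal.absNorm_apply, Submodule.cardQuot_apply, Nat.card_eq_fintype_card, h] at this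
      rw [map_natCast] at this; exact_mod_cast this
    have hrg : g ^ 5 + 6 * g ^ 4 + 10 * g ^ 3 + 4 * g ^ 2 + 2 = 0 := by
      have := congrArg (Ideal.Quotient.mk I) hr
      simp only [map_add, map_mul, map_pow, map_zero] at this
      rw [map_ofNat (Ideal.Quotient.mk I) 6, map_ofNat (Ideal.Quotient.mk I) 10,
        map_ofNat (Ideal.Quotient.mk I) 4, map_ofNat (Ideal.Quotient.mk I) 2] at this
      exact this
    -- `γ = g + 1`
    have hsq : g ^ 2 + 2 * g + 2 = 0 := by
      linear_combination hrg - (g ^ 2 + 6 * g + 11) * hg3 - (3 * g ^ 2 + 3 * g) * h3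
    have hcub : (g + 1) ^ 2 = -1 := by linear_combination hsq
    have : (g + 1) ^ 3 = g + 1 := by linear_combination hg3 + (g ^ 2 + g) * h3
    have h4 : (2:𝓞 K ⧸ I) * (g+1) = 0 := by linear_combination (g+1) * hcub - this
    have h5 : g + 1 = 0 := by linear_combination (g+1) * h3 - h4
    rw [h5] at hcub
    apply one_not
    rw [← Ideal.Quotient.eq_zero_iff_mem, map_one]
    linear_combination hcub
  · rw [h] at hmem
    apply h2case
    apply hp.mem_of_pow_mem 2
    have : (2 : 𝓞 K) ^ 2 = ((4 : ℕ) : 𝓞 K) := by norm_num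
    rw [this]; exact hmem
end
end

section
open Polynomial NumberField

lemma Ghat_real_unique {s t : ℝ} (hs : s ^ 5 - 4 * s ^ 4 + 8 * s ^ 3 - 8 * s ^ 2 + 4 = 0)
    (ht : t ^ 5 - 4 * t ^ 4 + 8 * t ^ 3 - 8 * t ^ 2 + 4 = 0) : s = t := by
  have neg : ∀ u : ℝ, u ^ 5 - 4 * u ^ 4 + 8 * u ^ 3 - 8 * u ^ 2 + 4 = 0 → u < 0 := by
    intro u hu
    by_contra hc
    push Not at hc
    have h0 : u * (u ^ 2 - 2 * u + 2) ^ 2 - 4 * u + 4 = 0 := by linear_combination hu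
    rcases le_or_gt u 1 with h1 | h1
    · nlinarith [mul_nonneg hc (sq_nonneg (u ^ 2 - 2 * u + 2)), sq_nonneg (u^2-2*u+2-1), sq_nonneg (u-1)]
    · obtain ⟨v, rfl⟩ : ∃ v, u = 1 + v := ⟨u - 1, by ring⟩
      have hv : 0 < v := by linarith
      have : v ^ 5 + v ^ 4 + 2 * v ^ 3 + 2 * v ^ 2 - 3 * v + 1 = 0 := by linear_combination h0
      nlinarith [pow_pos hv 3, pow_pos hv 5, sq_nonneg (v ^ 2 + v/2 - 1/2), sq_nonneg (v - 1/2), sq_nonneg (v^2-1/4), mul_nonneg hv.le (sq_nonneg (v-1/2))]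
  have hs' := neg s hs
  have ht' := neg t ht
  have hst : 0 < s * t := mul_pos_of_neg_of_neg hs' ht'
  have hQ : 0 < (s ^ 4 + s ^ 2 * (s * t) + (s * t) ^ 2 + t ^ 2 * (s * t) + t ^ 4)
      + 4 * ((-s) ^ 3 + (-s) * (s * t) + (-t) * (s * t) + (-t) ^ 3) + 8 * (s ^ 2 + s * t + t ^ 2)
      + 8 * (-s + -t) := by
    have : 0 < -s := by linarith
    have : 0 < -t := by linarith
    positivity
  have hm : (s - t) * ((s ^ 4 + s ^ 2 * (s * t) + (s * t) ^ 2 + t ^ 2 * (s * t) + t ^ 4)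
      + 4 * ((-s) ^ 3 + (-s) * (s * t) + (-t) * (s * t) + (-t) ^ 3) + 8 * (s ^ 2 + s * t + t ^ 2)
      + 8 * (-s + -t)) = 0 := by linear_combination hs - ht
  rcases mul_eq_zero.mp hm with h | h
  · linarith
  · linarith

section
variable {K : Type*} [Field K] [NumberField K]

lemma coords_inj {r : 𝓞 K} (hx : aeval (r : K) qE = 0) {x0 x1 x2 x3 x4 y0 y1 y2 y3 y4 : ℤ}
    (h : (x0 + x1 * r + x2 * r ^ 2 + x3 * r ^ 3 + x4 * r ^ 4 : 𝓞 K) =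
      y0 + y1 * r + y2 * r ^ 2 + y3 * r ^ 3 + y4 * r ^ 4) :
    x0 = y0 ∧ x1 = y1 ∧ x2 = y2 ∧ x3 = y3 ∧ x4 = y4 := by
  let p : ℤ[X] := C (x0 - y0) + C (x1 - y1) * X + C (x2 - y2) * X ^ 2 + C (x3 - y3) * X ^ 3 +
    C (x4 - y4) * X ^ 4
  have hp : aeval (r : K) p = 0 := by
    have h' := congrArg (algebraMap (𝓞 K) K) h
    simp only [map_add, map_mul, map_pow, map_intCast] at h'
    simp only [p, map_add, map_mul, map_pow, aeval_X, aeval_C, map_sub]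
    simp only [algebraMap_int_eq, eq_intCast]
    linear_combination h'
  have hdeg : p.degree < 5 := by
    have : p.degree ≤ 4 := by simp only [p]; compute_degree
    exact this.trans_lt (by norm_num)
  have hp0 : p = 0 := by
    by_contra hne
    have := minpoly.IsIntegrallyClosed.degree_le_of_ne_zero hne hp
    rw [minpolyZ_of_root hx, degree_eq_natDegree qE_monic.ne_zero, qE_natDegree] at this
    exact absurd hdeg (not_lt.mpr this)
  have hc : ∀ i, p.coeff i = 0 := fun i => by rw [hp0]; simp
  have c0 := hc 0
  have c1 := hc 1
  have c2 := hc 2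
  have c3 := hc 3
  have c4 := hc 4
  simp [p, coeff_X, coeff_C, -map_sub, -eq_intCast] at c0 c1 c2 c3 c4
  omega

/-- the element `η` -/
noncomputable def etaE (r : 𝓞 K) : 𝓞 K := -4 + 4 * r - 13 * r ^ 2 - 18 * r ^ 3 - 4 * r ^ 4

lemma eta_eq {r : 𝓞 K} (hx : aeval (r : K) qE = 0) :
    etaE r ^ 5 - 4 * etaE r ^ 4 + 8 * etaE r ^ 3 - 8 * etaE r ^ 2 + 4 = 0 := by
  have hr := root_eqO hx
  have h2 : etaE r ^ 2 = (-8) * r ^ 0 + (8) * r ^ 1 + (-24) * r ^ 2 + (-32) * r ^ 3 + (-7) * r ^ 4 := by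
    rw [pow_succ, pow_one]; unfold etaE; linear_combination ((12) * r ^ 0 + (-20) * r ^ 1 + (48) * r ^ 2 + (16) * r ^ 3) * hr
  have h3 : etaE r ^ 3 = (4) * r ^ 0 + (2) * r ^ 1 + (4) * r ^ 2 + (8) * r ^ 3 + (2) * r ^ 4 := by
    rw [pow_succ, h2]; unfold etaE; linear_combination ((14) * r ^ 0 + (-33) * r ^ 1 + (86) * r ^ 2 + (28) * r ^ 3) * hr
  have h4 : etaE r ^ 4 = (40) * r ^ 0 + (-20) * r ^ 1 + (92) * r ^ 2 + (126) * r ^ 3 + (28) * r ^ 4 := by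
    rw [pow_succ, h3]; unfold etaE; linear_combination ((-28) * r ^ 0 + (14) * r ^ 1 + (-20) * r ^ 2 + (-8) * r ^ 3) * hr
  have h5 : etaE r ^ 5 = (60) * r ^ 0 + (-32) * r ^ 1 + (144) * r ^ 2 + (184) * r ^ 3 + (40) * r ^ 4 := by
    rw [pow_succ, h4]; unfold etaE; linear_combination ((-110) * r ^ 0 + (136) * r ^ 1 + (-336) * r ^ 2 + (-112) * r ^ 3) * hr
  rw [h5, h4, h3, h2]; ring

/-- square root of `1 - η` -/
noncomputable def sigE (r : 𝓞 K) : 𝓞 K := (3) * r ^ 0 + (-3) * r ^ 1 + (6) * r ^ 2 + (9) * r ^ 3 + (2) * r ^ 4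

lemma sig_sq {r : 𝓞 K} (hx : aeval (r : K) qE = 0) :
    sigE r ^ 2 = 1 - etaE r := by
  have hr := root_eqO hx
  unfold etaE sigE; linear_combination ((2) * r ^ 0 + (-7) * r ^ 1 + (12) * r ^ 2 + (4) * r ^ 3) * hr

lemma gam_inv {r : 𝓞 K} (hx : aeval (r : K) qE = 0) :
    (1 + r) * ((-1) * r ^ 0 + (1) * r ^ 1 + (-5) * r ^ 2 + (-5) * r ^ 3 + (-1) * r ^ 4) = 1 := by
  have hr := root_eqO hx
  linear_combination ((-1) * r ^ 0) * hr

lemma del_inv {r : 𝓞 K} (hx : aeval (r : K) qE = 0) :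
    (-1 + r + r ^ 2) * ((3) * r ^ 0 + (-3) * r ^ 1 + (8) * r ^ 2 + (13) * r ^ 3 + (3) * r ^ 4) = 1 := by
  have hr := root_eqO hx
  linear_combination ((-2) * r ^ 0 + (3) * r ^ 1) * hr

lemma r7_eq {r : 𝓞 K} (hx : aeval (r : K) qE = 0) :
    r ^ 7 = 2 * etaE r * ((49) * r ^ 0 + (-10) * r ^ 1 + (98) * r ^ 2 + (227) * r ^ 3 + (95) * r ^ 4) := by
  have hr := root_eqO hx
  unfold etaE; linear_combination ((196) * r ^ 0 + (-236) * r ^ 1 + (677) * r ^ 2 + (760) * r ^ 3) * hr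

lemma eta_r2 {r : 𝓞 K} (hx : aeval (r : K) qE = 0) :
    etaE r = r ^ 2 * ((-5) * r ^ 0 + (-6) * r ^ 1 + (-12) * r ^ 2 + (-10) * r ^ 3 + (-2) * r ^ 4) := by
  have hr := root_eqO hx
  unfold etaE; linear_combination ((-2) * r ^ 0 + (2) * r ^ 1) * hr

lemma two_r {r : 𝓞 K} (hx : aeval (r : K) qE = 0) :
    2 * r = -4 + 4 * etaE r - 2 * etaE r ^ 2 + etaE r ^ 3 := by
  have hr := root_eqO hx
  have h2 : etaE r ^ 2 = (-8) * r ^ 0 + (8) * r ^ 1 + (-24) * r ^ 2 + (-32) * r ^ 3 + (-7) * r ^ 4 := by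
    rw [pow_succ, pow_one]; unfold etaE; linear_combination ((12) * r ^ 0 + (-20) * r ^ 1 + (48) * r ^ 2 + (16) * r ^ 3) * hr
  have h3 : etaE r ^ 3 = (4) * r ^ 0 + (2) * r ^ 1 + (4) * r ^ 2 + (8) * r ^ 3 + (2) * r ^ 4 := by
    rw [pow_succ, h2]; unfold etaE; linear_combination ((14) * r ^ 0 + (-33) * r ^ 1 + (86) * r ^ 2 + (28) * r ^ 3) * hr
  rw [h3, h2]; unfold etaE; ring

end
end

section
open Polynomial NumberField
section
variable {K : Type*} [Field K] [NumberField K]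

lemma sq_coords (hd : Module.finrank ℚ K = 5) {r : 𝓞 K} (hx : aeval (r : K) qE = 0) (s y : 𝓞 K)
    {x0 x1 x2 x3 x4 : ℤ}
    (h : (x0 + x1 * r + x2 * r ^ 2 + x3 * r ^ 3 + x4 * r ^ 4 : 𝓞 K) = s ^ 2 + 2 * etaE r * y) :
    x0 % 4 ≠ 3 ∧ x1 % 2 = 0 ∧ x3 % 2 = 0 := by
  have hr := root_eqO hx
  obtain ⟨s0, s1, s2, s3, s4, hs⟩ := exists_coords hd hx s
  obtain ⟨y0, y1, y2, y3, y4, hy⟩ := exists_coords hd hx y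
  obtain ⟨e0, e1, -, e3, -⟩ := coords_inj hx
    (y0 := s0 ^ 2 + 4 * ((-1) * (s1 * s4 + s2 * s3) + 3 * (s2 * s4 + s3 * s3 + s4 * s2) + (-13) * (s3 * s4 + s4 * s3) + 50 * (s4 * s4) + ((-2) * y0 + (4) * y1 + (-6) * y2 + (9) * y3 + (-14) * y4)))
    (y1 := 2 * (s0 * s1 + (-1) * (s2 * s4 + s3 * s3 + s4 * s2) + 6 * (s3 * s4 + s4 * s3) + (-26) * (s4 * s4) + ((4) * y0 + (-4) * y1 + (8) * y2 + (-12) * y3 + (18) * y4)))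
    (y2 := (s0 * s2 + s1 * s1 + s2 * s0) + (-4) * (s1 * s4 + s2 * s3 + s3 * s2 + s4 * s1) + (24) * (s2 * s4 + s3 * s3 + s4 * s2) + (-106) * (s3 * s4 + s4 * s3) + (412) * (s4 * s4) + ((-26) * y0 + (40) * y1 + (-56) * y2 + (88) * y3 + (-136) * y4))
    (y3 := 2 * ((s0 * s3 + s1 * s2) + (-5) * (s1 * s4 + s2 * s3 + s3 * s2 + s4 * s1) + 28 * (s2 * s4 + s3 * s3 + s4 * s2) + (-118) * (s3 * s4 + s4 * s3) + 447 * (s4 * s4) + ((-18) * y0 + (27) * y1 + (-40) * y2 + (62) * y3 + (-96) * y4)))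
    (y4 := (s0 * s4 + s1 * s3 + s2 * s2 + s3 * s1 + s4 * s0) + (-6) * (s1 * s4 + s2 * s3 + s3 * s2 + s4 * s1) + (26) * (s2 * s4 + s3 * s3 + s4 * s2) + (-100) * (s3 * s4 + s4 * s3) + (364) * (s4 * s4) + ((-8) * y0 + (12) * y1 + (-18) * y2 + (28) * y3 + (-44) * y4)) (h.trans (by
    have h5 : r ^ 5 = (-2) * r ^ 0 + (0) * r ^ 1 + (-4) * r ^ 2 + (-10) * r ^ 3 + (-6) * r ^ 4 := by linear_combination hr
    have h6 : r ^ 6 = (12) * r ^ 0 + (-2) * r ^ 1 + (24) * r ^ 2 + (56) * r ^ 3 + (26) * r ^ 4 := by linear_combination r * h5 + (-6) * h5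
    have h7 : r ^ 7 = (-52) * r ^ 0 + (12) * r ^ 1 + (-106) * r ^ 2 + (-236) * r ^ 3 + (-100) * r ^ 4 := by linear_combination r * h6 + 26 * h5
    have h8 : r ^ 8 = (200) * r ^ 0 + (-52) * r ^ 1 + (412) * r ^ 2 + (894) * r ^ 3 + (364) * r ^ 4 := by linear_combination r * h7 + (-100) * h5
    rw [hs, hy]
    unfold etaE
    push_cast
    linear_combination (s1 * s4 + s2 * s3 + s3 * s2 + s4 * s1) * h5 + (s2 * s4 + s3 * s3 + s4 * s2) * h6 + (s3 * s4 + s4 * s3) * h7 + (s4 * s4) * h8 + (y0 * (0) + y1 * ((-8) * r ^ 0) + y2 * ((12) * r ^ 0 + (-8) * r ^ 1) + y3 * ((-18) * r ^ 0 + (12) * r ^ 1 + (-8) * r ^ 2) + y4 * ((28) * r ^ 0 + (-18) * r ^ 1 + (12) * r ^ 2 + (-8) * r ^ 3)) * hr))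
  refine ⟨?_, ?_, ?_⟩
  · rcases Int.even_or_odd' s0 with ⟨k, hk | hk⟩
    · have : s0 ^ 2 = 4 * k ^ 2 := by rw [hk]; ring
      omega
    · have : s0 ^ 2 = 4 * (k ^ 2 + k) + 1 := by rw [hk]; ring
      omega
  · omega
  · omega

lemma nrReal_le {r : 𝓞 K} (hd : Module.finrank ℚ K = 5) (hx : aeval (r : K) qE = 0) :
    InfinitePlace.nrRealPlaces K ≤ 1 := by
  classical
  obtain ⟨B, hB, h5⟩ := exists_basis hd hx
  rw [← InfinitePlace.card_real_embeddings, Fintype.card_le_one_iff]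
  rintro ⟨φ, hφ⟩ ⟨ψ, hψ⟩
  have hG := congrArg (algebraMap (𝓞 K) K) (eta_eq hx)
  have h2 := congrArg (algebraMap (𝓞 K) K) (two_r hx)
  simp only [map_add, map_sub, map_mul, map_pow, map_neg, map_zero] at hG h2
  rw [map_ofNat (algebraMap (𝓞 K) K) 4, map_ofNat (algebraMap (𝓞 K) K) 8] at hG
  rw [map_ofNat (algebraMap (𝓞 K) K) 4, map_ofNat (algebraMap (𝓞 K) K) 2] at h2
  set t := (algebraMap (𝓞 K) K) (etaE r)
  have key : ∀ φ : K →+* ℂ, ComplexEmbedding.IsReal φ → ∃ a : ℝ, φ t = a ∧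
      a ^ 5 - 4 * a ^ 4 + 8 * a ^ 3 - 8 * a ^ 2 + 4 = 0 := by
    intro φ hφ
    refine ⟨hφ.embedding t, (ComplexEmbedding.IsReal.coe_embedding_apply hφ t).symm, ?_⟩
    have := congrArg hφ.embedding hG
    simp only [map_add, map_sub, map_mul, map_pow, map_zero] at this
    rw [map_ofNat hφ.embedding 4, map_ofNat hφ.embedding 8] at this
    exact this
  obtain ⟨a, ha, ha'⟩ := key φ hφ
  obtain ⟨b, hb, hb'⟩ := key ψ hψ
  have hab := Ghat_real_unique ha' hb'
  have hφψ : φ t = ψ t := by rw [ha, hb, hab]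
  have h2φ := congrArg φ h2
  have h2ψ := congrArg ψ h2
  simp only [map_add, map_sub, map_mul, map_pow, map_neg, map_ofNat] at h2φ h2ψ
  have hrr : φ (r : K) = ψ (r : K) := by
    rw [hφψ] at h2φ
    have := h2φ.trans h2ψ.symm
    exact mul_left_cancel₀ (by norm_num) this
  have : φ.toRatAlgHom = ψ.toRatAlgHom := B.algHom_ext (by rw [hB]; exact hrr)
  apply Subtype.ext
  ext z
  exact DFunLike.congr_fun this z

lemma rank_eq {r : 𝓞 K} (hd : Module.finrank ℚ K = 5) (hx : aeval (r : K) qE = 0) :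
    Units.rank K = 2 := by
  have h1 := nrReal_le hd hx
  have h2 := InfinitePlace.card_add_two_mul_card_eq_rank K
  have h3 := InfinitePlace.card_eq_nrRealPlaces_add_nrComplexPlaces K
  unfold Units.rank
  rw [hd] at h2
  omega

/-- the unit `1 + r` -/
noncomputable def gamU {r : 𝓞 K} (hx : aeval (r : K) qE = 0) : (𝓞 K)ˣ :=
  Units.mkOfMulEqOne _ _ (gam_inv hx)
/-- the unit `-1 + r + r ^ 2` -/
noncomputable def delU {r : 𝓞 K} (hx : aeval (r : K) qE = 0) : (𝓞 K)ˣ :=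
  Units.mkOfMulEqOne _ _ (del_inv hx)
/-- products of the known units -/
noncomputable def combU {r : 𝓞 K} (hx : aeval (r : K) qE = 0) (i j k : ℕ) : (𝓞 K)ˣ :=
  (-1) ^ i * gamU hx ^ j * delU hx ^ k

/-- square modulo `2η` -/
def SqMod (r : 𝓞 K) (u : (𝓞 K)ˣ) : Prop := ∃ s y : 𝓞 K, (u : 𝓞 K) = s ^ 2 + 2 * etaE r * y

lemma SqMod.mul_sq {r : 𝓞 K} {u : (𝓞 K)ˣ} (h : SqMod r u) (v : (𝓞 K)ˣ) : SqMod r (u * v ^ 2) := by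
  obtain ⟨s, y, h⟩ := h
  exact ⟨s * v, y * v ^ 2, by push_cast; rw [h]; ring⟩

lemma comb_sqMod {r : 𝓞 K} (hd : Module.finrank ℚ K = 5) (hx : aeval (r : K) qE = 0) {i j k : ℕ}
    (h : SqMod r (combU hx i j k)) : i % 2 = 0 ∧ j % 2 = 0 ∧ k % 2 = 0 := by
  have h' := h.mul_sq ((-1) ^ (i / 2) * gamU hx ^ (j / 2) * delU hx ^ (k / 2))⁻¹
  have e : combU hx i j k * (((-1) ^ (i / 2) * gamU hx ^ (j / 2) * delU hx ^ (k / 2))⁻¹) ^ 2 =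
      combU hx (i % 2) (j % 2) (k % 2) := by
    rw [inv_pow, mul_inv_eq_iff_eq_mul]
    unfold combU
    conv_lhs => rw [← Nat.mod_add_div i 2, ← Nat.mod_add_div j 2, ← Nat.mod_add_div k 2]
    simp only [pow_add, mul_pow, ← pow_mul, mul_comm 2]
    simp only [pow_mul]
    ac_rfl
  rw [e] at h'
  have hi : i % 2 < 2 := Nat.mod_lt _ (by norm_num)
  have hj : j % 2 < 2 := Nat.mod_lt _ (by norm_num)
  have hk : k % 2 < 2 := Nat.mod_lt _ (by norm_num)
  generalize i % 2 = i at *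
  generalize j % 2 = j at *
  generalize k % 2 = k at *
  obtain ⟨s, y, h'⟩ := h'
  have hc : ((combU hx i j k : (𝓞 K)ˣ) : 𝓞 K) = (-1) ^ i * (1 + r) ^ j * (-1 + r + r ^ 2) ^ k := by
    simp [combU, gamU, delU]
  rw [hc] at h'
  clear hc e
  interval_cases i <;> interval_cases j <;> interval_cases k
  · simp
  · have := sq_coords hd hx s y (x0 := -1) (x1 := 1) (x2 := 1) (x3 := 0) (x4 := 0)
      (by rw [← h']; push_cast; ring)
    omega
  · have := sq_coords hd hx s y (x0 := 1) (x1 := 1) (x2 := 0) (x3 := 0) (x4 := 0)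
      (by rw [← h']; push_cast; ring)
    omega
  · have := sq_coords hd hx s y (x0 := -1) (x1 := 0) (x2 := 2) (x3 := 1) (x4 := 0)
      (by rw [← h']; push_cast; ring)
    omega
  · have := sq_coords hd hx s y (x0 := -1) (x1 := 0) (x2 := 0) (x3 := 0) (x4 := 0)
      (by rw [← h']; push_cast; ring)
    omega
  · have := sq_coords hd hx s y (x0 := 1) (x1 := -1) (x2 := -1) (x3 := 0) (x4 := 0)
      (by rw [← h']; push_cast; ring)
    omega
  · have := sq_coords hd hx s y (x0 := -1) (x1 := -1) (x2 := 0) (x3 := 0) (x4 := 0)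
      (by rw [← h']; push_cast; ring)
    omega
  · have := sq_coords hd hx s y (x0 := 1) (x1 := 0) (x2 := -2) (x3 := -1) (x4 := 0)
      (by rw [← h']; push_cast; ring)
    omega

lemma exists_class (hd : Module.finrank ℚ K = 5) :
    ∃ c : (𝓞 K)ˣ → Bool × (Fin (Units.rank K) → ZMod 2), ∀ x y, c x = c y → ∃ v, x * y = v ^ 2 := by
  classical
  choose f hf _ using fun x => Units.exist_unique_eq_mul_prod K x
  refine ⟨fun x => (decide ((f x).1 = 1), fun i => ((f x).2 i : ZMod 2)), fun x y h => ?_⟩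
  have ht := Units.torsion_eq_one_or_neg_one_of_odd_finrank (K := K) (by rw [hd]; decide)
  rw [Prod.mk.injEq] at h
  obtain ⟨h1, h2⟩ := h
  have h1 : ((f x).1 : (𝓞 K)ˣ) * ((f y).1 : (𝓞 K)ˣ) = 1 := by
    rw [decide_eq_decide] at h1
    rcases ht (f x).1 with hx | hx
    · rw [OneMemClass.coe_eq_one] at hx
      rw [h1.mp hx, hx]; simp
    · rcases ht (f y).1 with hy | hy
      · rw [OneMemClass.coe_eq_one] at hy
        rw [h1.mpr hy, hy]; simp
      · rw [hx, hy]; simp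
  have h3 : ∀ i, ∃ k, (f x).2 i + (f y).2 i = 2 * k := by
    intro i
    have := congrFun h2 i
    rw [ZMod.intCast_eq_intCast_iff] at this
    have : (f x).2 i % 2 = (f y).2 i % 2 := this
    exact ⟨((f x).2 i + (f y).2 i) / 2, by omega⟩
  choose k hk using h3
  refine ⟨∏ i, Units.fundSystem K i ^ k i, ?_⟩
  conv_lhs => rw [hf x, hf y]
  rw [mul_mul_mul_comm, h1, one_mul, ← Finset.prod_mul_distrib, ← Finset.prod_pow]
  refine Finset.prod_congr rfl fun i _ => ?_
  rw [← zpow_add, hk, ← zpow_natCast, ← zpow_mul, mul_comm]; rfl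

lemma unit_square (hd : Module.finrank ℚ K = 5) {r : 𝓞 K} (hx : aeval (r : K) qE = 0)
    {u : (𝓞 K)ˣ} (h : SqMod r u) : ∃ v, u = v ^ 2 := by
  classical
  obtain ⟨c, hc⟩ := exists_class (K := K) hd
  let m : Fin 2 × Fin 2 × Fin 2 → (𝓞 K)ˣ := fun a => combU hx a.1 a.2.1 a.2.2
  have hinj : Function.Injective (c ∘ m) := by
    rintro ⟨a1, a2, a3⟩ ⟨b1, b2, b3⟩ hab
    obtain ⟨v, hv⟩ := hc _ _ hab
    have : m (a1, a2, a3) * m (b1, b2, b3) =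
        combU hx (a1 + b1) (a2 + b2) (a3 + b3) := by
      simp only [m, combU, pow_add]
      ac_rfl
    rw [this] at hv
    have := comb_sqMod hd hx (i := a1 + b1) (j := a2 + b2) (k := a3 + b3)
      ⟨v, 0, by rw [hv]; push_cast; ring⟩
    have := a1.2; have := a2.2; have := a3.2
    have := b1.2; have := b2.2; have := b3.2
    simp only [Prod.mk.injEq]
    refine ⟨Fin.ext ?_, Fin.ext ?_, Fin.ext ?_⟩ <;> omega
  have hbij : Function.Bijective (c ∘ m) := by
    rw [Fintype.bijective_iff_injective_and_card]
    refine ⟨hinj, ?_⟩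
    simp [rank_eq hd hx]
  obtain ⟨a, ha⟩ := hbij.2 (c u)
  obtain ⟨v, hv⟩ := hc _ _ ha
  have hm : m a = u * (v * u⁻¹) ^ 2 := by
    rw [mul_pow, ← hv]
    rw [pow_two, mul_comm u, mul_assoc, mul_assoc, mul_assoc]
    simp
  have h' : SqMod r (m a) := by rw [hm]; exact h.mul_sq _
  have h0 := comb_sqMod hd hx h'
  have h1 := a.1.2; have h2 := a.2.1.2; have h3 := a.2.2.2
  have hm1 : m a = 1 := by
    simp only [m]
    have e1 : (a.1 : ℕ) = 0 := by omega
    have e2 : (a.2.1 : ℕ) = 0 := by omega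
    have e3 : (a.2.2 : ℕ) = 0 := by omega
    rw [e1, e2, e3]; simp [combU]
  exact ⟨v, by rw [← hv, hm1, one_mul]⟩
end
end

section
open Polynomial NumberField

/-- the sextic `T * Ĝ(T)` -/
noncomputable def fH : ℤ[X] := X ^ 6 - 4 * X ^ 5 + 8 * X ^ 4 - 8 * X ^ 3 + 4 * X

/-- Solvability with denominator `n`. -/
def Sol (a : ℤ[X]) (n : ℕ) : Prop := ∃ B W : ℤ[X], B ^ 2 - a * W = C ((n : ℤ) ^ 2) * fH

lemma map_zmod_eq_zero {p : ℕ} {f : ℤ[X]} (h : f.map (Int.castRingHom (ZMod p)) = 0) :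
    C (p : ℤ) ∣ f := by
  rw [C_dvd_iff_dvd_coeff]
  intro i
  have := congrArg (fun g => coeff g i) h
  simp only [coeff_map, coeff_zero, eq_intCast] at this
  exact (ZMod.intCast_zmod_eq_zero_iff_dvd _ _).mp this

lemma dvd_of_common_root {F k : Type*} [Field F] [Field k] [Algebra F k] {t : k} (ht : IsIntegral F t)
    {a b w : F[X]} (ha0 : a ≠ 0) (had : a.natDegree ≤ 2) (h : b ^ 2 = a * w)
    (ha : aeval t a = 0) (hb : aeval t b = 0) (hw : aeval t w = 0) : a ∣ b := by
  obtain ⟨l, rfl⟩ := minpoly.dvd F t ha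
  obtain ⟨m, rfl⟩ := minpoly.dvd F t hb
  obtain ⟨v, rfl⟩ := minpoly.dvd F t hw
  have hμ := minpoly.ne_zero ht
  have hl0 : l ≠ 0 := right_ne_zero_of_mul ha0
  have hlm : m ^ 2 = l * v := by
    have : (minpoly F t) ^ 2 * m ^ 2 = (minpoly F t) ^ 2 * (l * v) := by linear_combination h
    exact mul_left_cancel₀ (pow_ne_zero 2 hμ) this
  apply mul_dvd_mul_left
  have hpos := minpoly.natDegree_pos ht
  rw [natDegree_mul hμ hl0] at had
  have hl1 : l.natDegree ≤ 1 := by omega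
  rcases Nat.lt_or_ge l.natDegree 1 with h0 | h1
  · have : l.natDegree = 0 := by omega
    exact (Polynomial.isUnit_iff_degree_eq_zero.mpr
      (by rw [degree_eq_natDegree hl0, this]; rfl)).dvd
  · have hirr : Irreducible l := Polynomial.irreducible_of_degree_eq_one
      (by rw [degree_eq_natDegree hl0, le_antisymm hl1 h1]; rfl)
    exact hirr.prime.dvd_of_dvd_pow ⟨v, hlm⟩

lemma descent {p : ℕ} [Fact p.Prime] {k : Type*} [Field k] [Algebra (ZMod p) k] {t : k}
    (ht : IsIntegral (ZMod p) t)
    {a B W : ℤ[X]} (had : a.natDegree ≤ 2) (hap : ¬ C (p : ℤ) ∣ a) {n : ℕ}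
    (h : B ^ 2 - a * W = C (((p * n : ℕ) : ℤ) ^ 2) * fH)
    (ha : aeval t a = 0) (hW : aeval t W = 0) : Sol a n := by
  set φ := Int.castRingHom (ZMod p)
  have hpr : Prime (C (p : ℤ)) := Polynomial.prime_C_iff.mpr (Nat.prime_iff_prime_int.mp Fact.out)
  have hp0 : (C (p : ℤ)) ≠ 0 := hpr.ne_zero
  have e : ∀ f : ℤ[X], aeval t (f.map φ) = aeval t f := fun f => aeval_map_algebraMap (ZMod p) t f
  have hm : (B.map φ) ^ 2 = a.map φ * W.map φ := by
    have := congrArg (Polynomial.map φ) h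
    simp only [Polynomial.map_sub, Polynomial.map_pow, Polynomial.map_mul, map_C] at this
    have hp : φ (((p * n : ℕ) : ℤ) ^ 2) = 0 := by simp
    rw [hp] at this
    simp only [C_0, zero_mul] at this
    exact sub_eq_zero.mp this
  have hB : aeval t (B.map φ) = 0 := by
    have := congrArg (aeval t) hm
    simp only [map_pow, map_mul, e, ha, zero_mul] at this
    rw [e]
    exact pow_eq_zero_iff (two_ne_zero) |>.mp this
  have hdvd := dvd_of_common_root ht (fun h0 => hap (map_zmod_eq_zero h0))
    (natDegree_map_le.trans had) hm (by rw [e, ha]) hB (by rw [e, hW])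
  obtain ⟨g', hg'⟩ := hdvd
  obtain ⟨g, rfl⟩ := Polynomial.map_surjective φ (ZMod.ringHom_surjective _) g'
  obtain ⟨B', hB'⟩ : C (p : ℤ) ∣ B - a * g := by
    apply map_zmod_eq_zero
    rw [Polynomial.map_sub, Polynomial.map_mul, hg', sub_self]
  have hB'' : B = a * g + C (p : ℤ) * B' := by rw [← hB']; ring
  have hC : C (((p * n : ℕ) : ℤ) ^ 2) = C (p : ℤ) ^ 2 * C ((n : ℤ) ^ 2) := by
    rw [← C_pow, ← C_mul]; congr 1; push_cast; ring
  rw [hC] at h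
  have hV : a * (W - a * g ^ 2 - 2 * C (p : ℤ) * g * B') =
      C (p : ℤ) * (C (p : ℤ) * (B' ^ 2 - C ((n : ℤ) ^ 2) * fH)) := by
    rw [hB''] at h
    linear_combination -h
  obtain ⟨V, hV1⟩ := (hpr.dvd_or_dvd ⟨_, hV⟩).resolve_left hap
  rw [hV1] at hV
  have hV' : a * V = C (p : ℤ) * (B' ^ 2 - C ((n : ℤ) ^ 2) * fH) := by
    apply mul_left_cancel₀ hp0
    linear_combination hV
  obtain ⟨V', hV2⟩ := (hpr.dvd_or_dvd ⟨_, hV'⟩).resolve_left hap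
  rw [hV2] at hV'
  refine ⟨B', V', ?_⟩
  apply mul_left_cancel₀ hp0
  linear_combination -hV'

lemma fH_deriv : derivative fH = 6 * X ^ 5 - 20 * X ^ 4 + 32 * X ^ 3 - 24 * X ^ 2 + 4 := by
  unfold fH
  simp
  ring

lemma aeval_fH {R : Type*} [CommRing R] (t : R) :
    aeval t fH = t ^ 6 - 4 * t ^ 5 + 8 * t ^ 4 - 8 * t ^ 3 + 4 * t := by
  unfold fH
  simp only [map_add, map_sub, map_mul, map_pow, aeval_X]
  rw [map_ofNat (aeval t) 4, map_ofNat (aeval t) 8]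

lemma deriv_root {k : Type*} [Field k] {t : k} {a B W : ℤ[X]} {n : ℕ}
    (h : B ^ 2 - a * W = C ((n : ℤ) ^ 2) * fH) (hn : (n : k) ≠ 0)
    (ha : aeval t a = 0) (hW : aeval t W = 0) (hf : aeval t fH = 0) :
    aeval t B = 0 ∧ 6 * t ^ 5 - 20 * t ^ 4 + 32 * t ^ 3 - 24 * t ^ 2 + 4 = 0 := by
  have hB : aeval t B = 0 := by
    have := congrArg (aeval t) h
    simp only [map_sub, map_pow, map_mul, ha, hf, zero_mul, mul_zero, sub_zero] at this
    exact pow_eq_zero_iff (two_ne_zero) |>.mp this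
  refine ⟨hB, ?_⟩
  have := congrArg (fun f => aeval t (derivative f)) h
  simp only [derivative_sub, derivative_mul, derivative_pow, derivative_C, zero_mul, zero_add,
    map_sub, map_add, map_mul, ha, hW, hf, mul_zero, map_pow, hB, aeval_C, fH_deriv, aeval_X] at this
  simp only [map_natCast, Nat.cast_ofNat, Nat.add_one_sub_one, pow_one, mul_zero, zero_mul, add_zero, sub_zero, hB] at this
  rw [map_ofNat (aeval t) 6, map_ofNat (aeval t) 20, map_ofNat (aeval t) 32, map_ofNat (aeval t) 24,
    map_ofNat (aeval t) 4] at this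
  have h2 := this.symm
  rw [mul_eq_zero] at h2
  exact h2.resolve_left (by simpa using hn)
end

section
open Polynomial NumberField

/-- the reversed quadratic -/
noncomputable def aH (a0 a1 a2 : ℤ) : ℤ[X] := C a0 + C a1 * X + C a2 * X ^ 2

lemma aH_deg (a0 a1 a2 : ℤ) : (aH a0 a1 a2).natDegree ≤ 2 := by unfold aH; compute_degree

lemma aeval_aH {R : Type*} [CommRing R] (t : R) (a0 a1 a2 : ℤ) :
    aeval t (aH a0 a1 a2) = a0 + a1 * t + a2 * t ^ 2 := by
  unfold aH
  simp only [map_add, map_mul, map_pow, aeval_X, aeval_C]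
  simp

lemma core_k {p : ℕ} [Fact p.Prime] {k : Type*} [Field k] [CharP k p] {t : k} (ht : IsIntegral ℤ t)
    {a B W : ℤ[X]} (had : a.natDegree ≤ 2) (hprim : ∀ p : ℕ, p.Prime → ¬ C (p : ℤ) ∣ a)
    {n : ℕ} (hn : 0 < n) (hmin : ∀ m, 0 < m → m < n → ¬ Sol a m)
    (h : B ^ 2 - a * W = C ((n : ℤ) ^ 2) * fH)
    (ha : aeval t a = 0) (hW : aeval t W = 0) (hf : aeval t fH = 0) :
    ¬ p ∣ n ∧ aeval t B = 0 ∧ 6 * t ^ 5 - 20 * t ^ 4 + 32 * t ^ 3 - 24 * t ^ 2 + 4 = 0 := by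
  have hpn : ¬ p ∣ n := by
    rintro ⟨m, rfl⟩
    let _ := ZMod.algebra k p
    have hp : p.Prime := Fact.out
    have hm : 0 < m := Nat.pos_of_mul_pos_left hn
    refine hmin m hm ?_ (descent (k := k) (t := t) (p := p) ht.tower_top had (hprim p hp) h ha hW)
    nlinarith [hp.two_le]
  refine ⟨hpn, deriv_root h ?_ ha hW hf⟩
  rwa [Ne, CharP.cast_eq_zero_iff k p]

lemma coprime_int {a0 a1 a2 : ℤ} (h0 : a0 % 2 = 1)
    (hprim : ∀ p : ℕ, p.Prime → ¬ C (p : ℤ) ∣ aH a0 a1 a2) {B W : ℤ[X]}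
    {n : ℕ} (hn : 0 < n) (hmin : ∀ m, 0 < m → m < n → ¬ Sol (aH a0 a1 a2) m)
    (h : B ^ 2 - aH a0 a1 a2 * W = C ((n : ℤ) ^ 2) * fH) : IsCoprime a0 (W.eval 0) := by
  apply isCoprime_of_prime_dvd
  · rintro ⟨rfl, -⟩; norm_num at h0
  · intro z hz hz1 hz2
    have hp : z.natAbs.Prime := Int.prime_iff_natAbs_prime.mp hz
    have := Fact.mk hp
    have hz1' : ((a0 : ℤ) : ZMod z.natAbs) = 0 := by
      rw [ZMod.intCast_zmod_eq_zero_iff_dvd]; exact Int.natAbs_dvd.mpr hz1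
    have hz2' : ((W.eval 0 : ℤ) : ZMod z.natAbs) = 0 := by
      rw [ZMod.intCast_zmod_eq_zero_iff_dvd]; exact Int.natAbs_dvd.mpr hz2
    obtain ⟨-, -, hd⟩ := core_k (p := z.natAbs) (k := ZMod z.natAbs) (t := 0) isIntegral_zero
      (aH_deg _ _ _) hprim hn hmin h (by rw [aeval_aH, hz1']; simp)
      (by
        have := aeval_algebraMap_apply (ZMod z.natAbs) (0 : ℤ) W
        rw [map_zero] at this
        rw [this]
        simpa [coe_aeval_eq_eval] using hz2') (by rw [aeval_fH]; ring)
    have h4 : ((4 : ℕ) : ZMod z.natAbs) = 0 := by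
      push_cast; linear_combination hd
    rw [ZMod.natCast_eq_zero_iff] at h4
    have : z.natAbs ∣ 2 := hp.dvd_of_dvd_pow (n := 2) (by simpa using h4)
    have h2 : z.natAbs = 2 := (Nat.prime_dvd_prime_iff_eq hp Nat.prime_two).mp this
    have : (2 : ℤ) ∣ a0 := by
      have := Int.natAbs_dvd.mpr hz1
      rw [h2] at this; exact_mod_cast this
    omega

lemma k_false {p : ℕ} [Fact p.Prime] {k : Type*} [Field k] [CharP k p] {t : k}
    {a0 a1 a2 : ℤ} (h0 : a0 % 2 = 1)
    (hprim : ∀ p : ℕ, p.Prime → ¬ C (p : ℤ) ∣ aH a0 a1 a2) {B W : ℤ[X]}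
    {n : ℕ} (hn : 0 < n) (hmin : ∀ m, 0 < m → m < n → ¬ Sol (aH a0 a1 a2) m)
    (h : B ^ 2 - aH a0 a1 a2 * W = C ((n : ℤ) ^ 2) * fH) (hti : IsIntegral ℤ t)
    (ht : t ^ 5 - 4 * t ^ 4 + 8 * t ^ 3 - 8 * t ^ 2 + 4 = 0)
    (ha : aeval t (aH a0 a1 a2) = 0) (hW : aeval t W = 0) : False := by
  obtain ⟨hpn, hB, hd⟩ := core_k (p := p) hti (aH_deg _ _ _) hprim hn hmin h ha hW
    (by rw [aeval_fH]; linear_combination t * ht)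
  have hp : p.Prime := Fact.out
  have ha' := ha
  rw [aeval_aH] at ha'
  have two : (2 : k) ≠ 0 := by
    intro h2
    have : t ^ 5 = 0 := by
      linear_combination ht + (2 * t ^ 4 - 4 * t ^ 3 + 4 * t ^ 2 - 2) * h2
    have t0 : t = 0 := pow_eq_zero_iff (by norm_num) |>.mp this
    rw [t0] at ha'
    obtain ⟨c, hc⟩ : ∃ c, a0 = 2 * c + 1 := ⟨a0 / 2, by omega⟩
    rw [hc] at ha'
    push_cast at ha'
    have : (1 : k) = 0 := by linear_combination ha' - c * h2
    exact one_ne_zero this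
  have tne : t ≠ 0 := by
    rintro rfl
    apply two
    have : (2 : k) ^ 2 = 0 := by linear_combination ht
    exact pow_eq_zero_iff (by norm_num) |>.mp this
  have hD : 5 * t ^ 4 - 16 * t ^ 3 + 24 * t ^ 2 - 16 * t = 0 := by
    have : t * (5 * t ^ 4 - 16 * t ^ 3 + 24 * t ^ 2 - 16 * t) = 0 := by
      linear_combination hd - ht
    exact (mul_eq_zero.mp this).resolve_left tne
  have four : (4 : k) ≠ 0 := by
    have : (4 : k) = 2 ^ 2 := by norm_num
    rw [this]; exact pow_ne_zero 2 two
  have h277 : (277 : k) = 0 := by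
    have : (4 : k) * 277 = 0 := by
      linear_combination (277 + 3088 * t - 2354 * t ^ 2 + 1420 * t ^ 3) * ht +
        (772 + 431 * t - 1176 * t ^ 2 + 698 * t ^ 3 - 284 * t ^ 4) * hD
    exact (mul_eq_zero.mp this).resolve_left four
  have ht23 : t = 23 := by
    have h1 : (4 : k) * (142 * t - 219) = 0 := by
      linear_combination -(219 - 30 * t + 50 * t ^ 2) * ht -
        (28 - 55 * t + 14 * t ^ 2 - 10 * t ^ 3) * hD
    have h2 := (mul_eq_zero.mp h1).resolve_left four
    -- `142 * 2 = 284 = 7 mod 277`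
    have h3 : (142 : k) * (t - 23) = 0 := by linear_combination h2 - 11 * h277
    have h4 : (142 : k) ≠ 0 := by
      intro h4
      have : (1 : k) = 0 := by linear_combination 119 * h4 - 61 * h277
      exact one_ne_zero this
    have := (mul_eq_zero.mp h3).resolve_left h4
    linear_combination this
  have hp277 : p = 277 := by
    have : ((277 : ℕ) : k) = 0 := by exact_mod_cast h277
    rw [CharP.cast_eq_zero_iff k p] at this
    exact (Nat.prime_dvd_prime_iff_eq hp (by norm_num)).mp this
  subst hp277
  have conv : ∀ f : ℤ[X], aeval t f = 0 → (277 : ℤ) ∣ f.eval 23 := by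
    intro f hf
    have := aeval_algebraMap_apply k (23 : ℤ) f
    have h23 : algebraMap ℤ k 23 = t := by rw [ht23]; simp
    rw [h23, hf] at this
    simp only [coe_aeval_eq_eval, algebraMap_int_eq, eq_intCast] at this
    exact (CharP.intCast_eq_zero_iff k 277 _).mp this.symm
  obtain ⟨x, hx⟩ := conv _ ha
  obtain ⟨y, hy⟩ := conv _ hW
  obtain ⟨z, hz⟩ := conv _ hB
  have he := congrArg (eval 23) h
  simp only [eval_sub, eval_mul, eval_pow, eval_C, hx, hy, hz] at he
  have hf23 : eval 23 fH = 277 * 449213 := by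
    unfold fH; simp
  rw [hf23] at he
  have h5 : (n : ℤ) ^ 2 * 449213 = 277 * (z ^ 2 - x * y) := by linarith
  have hpr : Prime (277 : ℤ) := by
    have : Nat.Prime 277 := by norm_num
    exact_mod_cast Nat.prime_iff_prime_int.mp this
  rcases hpr.dvd_or_dvd ⟨_, h5⟩ with h6 | h6
  · have := hpr.dvd_of_dvd_pow h6
    exact hpn (by exact_mod_cast this)
  · norm_num at h6
end

section
open Polynomial NumberField
section
variable {K : Type*} [Field K] [NumberField K]

lemma aeval_hom {R S : Type*} [CommRing R] [CommRing S] (f : R →+* S) (x : R) (p : ℤ[X]) :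
    aeval (f x) p = f (aeval x p) := by
  rw [aeval_def, aeval_def, hom_eval₂]
  congr 1
  exact RingHom.ext_int _ _

lemma coprime_eta {r : 𝓞 K} (hx : aeval (r : K) qE = 0)
    {a0 a1 a2 : ℤ} (h0 : a0 % 2 = 1)
    (hprim : ∀ p : ℕ, p.Prime → ¬ C (p : ℤ) ∣ aH a0 a1 a2) {B W : ℤ[X]}
    {n : ℕ} (hn : 0 < n) (hmin : ∀ m, 0 < m → m < n → ¬ Sol (aH a0 a1 a2) m)
    (h : B ^ 2 - aH a0 a1 a2 * W = C ((n : ℤ) ^ 2) * fH) :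
    IsCoprime (aeval (etaE r) (aH a0 a1 a2)) (aeval (etaE r) W) := by
  rw [← Ideal.isCoprime_span_singleton_iff, Ideal.isCoprime_iff_sup_eq]
  by_contra hne
  obtain ⟨q, hq, hle⟩ := Ideal.exists_le_maximal _ hne
  have ha : aeval (etaE r) (aH a0 a1 a2) ∈ q :=
    hle (Ideal.mem_sup_left (Ideal.mem_span_singleton_self _))
  have hW : aeval (etaE r) W ∈ q :=
    hle (Ideal.mem_sup_right (Ideal.mem_span_singleton_self _))
  let _ : Field (𝓞 K ⧸ q) := Ideal.Quotient.field q
  have hqb : q ≠ ⊥ := Ring.ne_bot_of_isMaximal_of_not_isField hq (RingOfIntegers.not_isField K)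
  obtain ⟨p, hp⟩ := CharP.exists (𝓞 K ⧸ q)
  have hp' : p.Prime := by
    rcases CharP.char_is_prime_or_zero (𝓞 K ⧸ q) p with h1 | h1
    · exact h1
    · exfalso
      have hm := Ideal.absNorm_mem q
      rw [← Ideal.Quotient.eq_zero_iff_mem, map_natCast, CharP.cast_eq_zero_iff (𝓞 K ⧸ q) p, h1,
        zero_dvd_iff, Ideal.absNorm_eq_zero_iff] at hm
      exact hqb hm
  have := Fact.mk hp'
  refine k_false (p := p) (k := 𝓞 K ⧸ q) (t := Ideal.Quotient.mk q (etaE r)) h0 hprim hn hmin h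
    ?_ ?_ ?_ ?_
  · exact map_isIntegral_int (Ideal.Quotient.mk q) (Algebra.IsIntegral.isIntegral (R := ℤ) (etaE r))
  · have := congrArg (Ideal.Quotient.mk q) (eta_eq hx)
    rw [map_add, map_sub, map_add, map_sub, map_mul, map_mul, map_mul, map_pow, map_pow, map_pow,
      map_pow, map_ofNat (Ideal.Quotient.mk q) 4, map_ofNat (Ideal.Quotient.mk q) 8, map_zero] at this
    exact this
  · exact (aeval_hom (Ideal.Quotient.mk q) _ _).trans (Ideal.Quotient.eq_zero_iff_mem.mpr ha)
  · exact (aeval_hom (Ideal.Quotient.mk q) _ _).trans (Ideal.Quotient.eq_zero_iff_mem.mpr hW)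

lemma not_r_unit (hd : Module.finrank ℚ K = 5) {r : 𝓞 K} (hx : aeval (r : K) qE = 0) (y : 𝓞 K) :
    1 ≠ r * y := by
  intro h
  obtain ⟨y0, y1, y2, y3, y4, hy⟩ := exists_coords hd hx y
  have hr := root_eqO hx
  obtain ⟨e, -⟩ := coords_inj hx (x0 := 1) (x1 := 0) (x2 := 0) (x3 := 0) (x4 := 0)
    (y0 := -2 * y4) (y1 := y0) (y2 := y1 - 4 * y4) (y3 := y2 - 10 * y4) (y4 := y3 - 6 * y4) (by
      push_cast
      rw [hy] at h
      linear_combination h + y4 * hr)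
  omega

lemma square_eta (hd : Module.finrank ℚ K = 5) {r : 𝓞 K} (hx : aeval (r : K) qE = 0)
    {a0 a1 a2 : ℤ} (h0 : a0 % 2 = 1) (hpos : 0 < a0) (h1 : a1 % 2 = 1) (h2 : a2 % 2 = 0)
    (hprim : ∀ p : ℕ, p.Prime → ¬ C (p : ℤ) ∣ aH a0 a1 a2) {B W : ℤ[X]}
    {n : ℕ} (hn : 0 < n) (hmin : ∀ m, 0 < m → m < n → ¬ Sol (aH a0 a1 a2) m)
    (h : B ^ 2 - aH a0 a1 a2 * W = C ((n : ℤ) ^ 2) * fH) :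
    ∃ (c : ℤ) (β : 𝓞 K), a0 = c ^ 2 ∧ (a0 + a1 * etaE r + a2 * etaE r ^ 2 : 𝓞 K) = β ^ 2 := by
  have hr := root_eqO hx
  have hc : ∃ c : ℤ, a0 = c ^ 2 := by
    have he := congrArg (eval 0) h
    simp only [eval_sub, eval_mul, eval_pow, eval_C] at he
    have hf : eval 0 fH = 0 := by unfold fH; simp
    have ha : eval 0 (aH a0 a1 a2) = a0 := by unfold aH; simp
    rw [hf, ha] at he
    have he' : a0 * W.eval 0 = (B.eval 0) ^ 2 := by linear_combination -he
    obtain ⟨c, hc | hc⟩ := Int.sq_of_isCoprime (coprime_int h0 hprim hn hmin h) he'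
    · exact ⟨c, hc⟩
    · exfalso; nlinarith [sq_nonneg c]
  obtain ⟨c, hc⟩ := hc
  refine ⟨c, ?_⟩
  have hPID := isPID hd hx
  have he := congrArg (aeval (etaE r)) h
  have hf : aeval (etaE r) fH = 0 := by
    rw [aeval_fH]; linear_combination etaE r * eta_eq hx
  rw [map_sub, map_mul, map_mul, map_pow, hf, mul_zero] at he
  have he' : aeval (etaE r) (aH a0 a1 a2) * aeval (etaE r) W = (aeval (etaE r) B) ^ 2 := by
    linear_combination -he
  obtain ⟨β, ε, hε⟩ := exists_associated_pow_of_mul_eq_pow' (coprime_eta hx h0 hprim hn hmin h) he'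
  rw [aeval_aH] at hε
  obtain ⟨k, hk⟩ : ∃ k, a1 = -a0 + 2 * k := ⟨(a1 + a0) / 2, by omega⟩
  obtain ⟨k', hk'⟩ : ∃ k', a2 = 2 * k' := ⟨a2 / 2, by omega⟩
  obtain ⟨β0, β1, β2, β3, β4, hβ⟩ := exists_coords hd hx β
  have hη := eta_r2 hx
  set q := ((-5) * r ^ 0 + (-6) * r ^ 1 + (-12) * r ^ 2 + (-10) * r ^ 3 + (-2) * r ^ 4) with hq
  have hodd : β0 % 2 = 1 := by
    by_contra hev
    obtain ⟨m, hm⟩ : ∃ m, β0 = 2 * m := ⟨β0 / 2, by omega⟩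
    obtain ⟨l, hl⟩ : ∃ l, a0 = 2 * l + 1 := ⟨a0 / 2, by omega⟩
    have two : (2 : 𝓞 K) = r * (-r ^ 4 - 6 * r ^ 3 - 10 * r ^ 2 - 4 * r) := by
      linear_combination hr
    have hβ' : β = r * (m * (-r ^ 4 - 6 * r ^ 3 - 10 * r ^ 2 - 4 * r) + β1 + β2 * r + β3 * r ^ 2 +
        β4 * r ^ 3) := by
      rw [hβ, hm]; push_cast; linear_combination m * two
    set z := (m * (-r ^ 4 - 6 * r ^ 3 - 10 * r ^ 2 - 4 * r) + β1 + β2 * r + β3 * r ^ 2 +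
        β4 * r ^ 3)
    apply not_r_unit hd hx (r * z ^ 2 * ε - l * (-r ^ 4 - 6 * r ^ 3 - 10 * r ^ 2 - 4 * r) -
      a1 * (r * q) - a2 * (r * q * etaE r))
    have e1 : ((a0 : ℤ) : 𝓞 K) = 2 * l + 1 := by rw [hl]; push_cast; ring
    rw [hβ'] at hε
    linear_combination -hε - e1 - l * two - a1 * hη - a2 * etaE r * hη
  obtain ⟨m, hm⟩ : ∃ m, β0 = 2 * m + 1 := ⟨β0 / 2, by omega⟩
  have hcop : IsCoprime β r := by
    refine ⟨1, -(m * (-r ^ 4 - 6 * r ^ 3 - 10 * r ^ 2 - 4 * r) + β1 + β2 * r + β3 * r ^ 2 +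
        β4 * r ^ 3), ?_⟩
    rw [hβ, hm]; push_cast; linear_combination m * hr
  obtain ⟨u, w, huw⟩ := hcop.pow_right (n := 7)
  have h7 := r7_eq hx
  set Q := ((49) * r ^ 0 + (-10) * r ^ 1 + (98) * r ^ 2 + (227) * r ^ 3 + (95) * r ^ 4)
  have hs := sig_sq hx
  have hsq : SqMod r ε := by
    refine ⟨u * c * sigE r, u ^ 2 * (k + k' * etaE r) +
      ε * (2 * Q * w - 2 * etaE r * Q ^ 2 * w ^ 2), ?_⟩
    have e0 : ((a0 : ℤ) : 𝓞 K) = c ^ 2 := by rw [hc]; push_cast; ring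
    have e1 : ((a1 : ℤ) : 𝓞 K) = -a0 + 2 * k := by rw [hk]; push_cast; ring
    have e2 : ((a2 : ℤ) : 𝓞 K) = 2 * k' := by rw [hk']; push_cast; ring
    have huw' : u * β = 1 - 2 * etaE r * Q * w := by linear_combination huw - w * h7
    have e3 : (u * β) ^ 2 = (1 - 2 * etaE r * Q * w) ^ 2 := by rw [huw']
    linear_combination u ^ 2 * hε - ε * e3 - u ^ 2 * c ^ 2 * hs + u ^ 2 * (e0 + etaE r * e1 + etaE r ^ 2 * e2 - etaE r * e0)
  obtain ⟨v, hv⟩ := unit_square hd hx hsq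
  refine ⟨v * β, hc, ?_⟩
  rw [hv] at hε
  push_cast at hε
  linear_combination -hε
end
end

section
open Polynomial NumberField

lemma sol_exists {a1 a2 b0 b1 w2 w1 w0 : ℚ}
    (e1 : 0 = -(w2 + a1)) (e2 : 2 = -(w1 + a1 * w2 + a2))
    (e3 : b1 ^ 2 - 2 = -(w0 + a1 * w1 + a2 * w2))
    (e4 : 2 * b1 * b0 + b1 + 1 = -(a1 * w0 + a2 * w1)) (e5 : b0 ^ 2 + b0 = -(a2 * w0))
    {d : ℕ} (hd : 0 < d) {x y : ℤ} (hx : (d : ℚ) * a1 = x) (hy : (d : ℚ) * a2 = y) :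
    ∃ n : ℕ, 0 < n ∧ Sol (aH d x y) n := by
  obtain ⟨M, hM, B0, B1, W2, W1, W0, h0, h1, h2, h3, h4⟩ : ∃ M : ℕ, 0 < M ∧
      ∃ B0 B1 W2 W1 W0 : ℤ, (M : ℚ) * b0 = B0 ∧ (M : ℚ) * b1 = B1 ∧ (M : ℚ) * w2 = W2 ∧
        (M : ℚ) * w1 = W1 ∧ (M : ℚ) * w0 = W0 := by
    refine ⟨b0.den * b1.den * w2.den * w1.den * w0.den, by positivity,
      b0.num * b1.den * w2.den * w1.den * w0.den, b0.den * b1.num * w2.den * w1.den * w0.den,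
      b0.den * b1.den * w2.num * w1.den * w0.den, b0.den * b1.den * w2.den * w1.num * w0.den,
      b0.den * b1.den * w2.den * w1.den * w0.num, ?_, ?_, ?_, ?_, ?_⟩ <;> push_cast
    · linear_combination (b1.den * w2.den * w1.den * w0.den : ℚ) * Rat.den_mul_eq_num b0
    · linear_combination (b0.den * w2.den * w1.den * w0.den : ℚ) * Rat.den_mul_eq_num b1
    · linear_combination (b0.den * b1.den * w1.den * w0.den : ℚ) * Rat.den_mul_eq_num w2
    · linear_combination (b0.den * b1.den * w2.den * w0.den : ℚ) * Rat.den_mul_eq_num w1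
    · linear_combination (b0.den * b1.den * w2.den * w1.den : ℚ) * Rat.den_mul_eq_num w0
  have f1 : (0 : ℤ) = d * W2 + M * x := by
    have : (0 : ℚ) = d * W2 + M * x := by
      rw [← hx, ← h2]; linear_combination -(d * M : ℚ) * e1
    exact_mod_cast this
  have f2 : 2 * (d : ℤ) * M = -(d * W1 + x * W2 + M * y) := by
    have : 2 * (d : ℚ) * M = -(d * W1 + x * W2 + M * y) := by
      rw [← hx, ← hy, ← h2, ← h3]; linear_combination (d * M : ℚ) * e2
    exact_mod_cast this
  have f3 : (d : ℤ) * (B1 ^ 2 - 2 * M ^ 2) = -(M * (d * W0 + x * W1 + y * W2)) := by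
    have : (d : ℚ) * (B1 ^ 2 - 2 * M ^ 2) = -(M * (d * W0 + x * W1 + y * W2)) := by
      rw [← hx, ← hy, ← h1, ← h2, ← h3, ← h4]; linear_combination (d * M ^ 2 : ℚ) * e3
    exact_mod_cast this
  have f4 : (d : ℤ) * (2 * B1 * B0 + M * B1 + M ^ 2) = -(M * (x * W0 + y * W1)) := by
    have : (d : ℚ) * (2 * B1 * B0 + M * B1 + M ^ 2) = -(M * (x * W0 + y * W1)) := by
      rw [← hx, ← hy, ← h0, ← h1, ← h3, ← h4]; linear_combination (d * M ^ 2 : ℚ) * e4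
    exact_mod_cast this
  have f5 : (d : ℤ) * (B0 ^ 2 + M * B0) = -(M * (y * W0)) := by
    have : (d : ℚ) * (B0 ^ 2 + M * B0) = -(M * (y * W0)) := by
      rw [← hy, ← h0, ← h4]; linear_combination (d * M ^ 2 : ℚ) * e5
    exact_mod_cast this
  refine ⟨d * M, by positivity,
    (d : ℤ[X]) * (2 * (B0 : ℤ[X]) + (M : ℤ[X])) * X ^ 3 + 2 * (d : ℤ[X]) * (B1 : ℤ[X]) * X ^ 2,
    -4 * (d : ℤ[X]) * (M : ℤ[X]) * ((M : ℤ[X]) * X + (W2 : ℤ[X]) * X ^ 2 + (W1 : ℤ[X]) * X ^ 3 +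
      (W0 : ℤ[X]) * X ^ 4), ?_⟩
  have g1 := congrArg (Int.cast : ℤ → ℤ[X]) f1
  have g2 := congrArg (Int.cast : ℤ → ℤ[X]) f2
  have g3 := congrArg (Int.cast : ℤ → ℤ[X]) f3
  have g4 := congrArg (Int.cast : ℤ → ℤ[X]) f4
  have g5 := congrArg (Int.cast : ℤ → ℤ[X]) f5
  push_cast at g1 g2 g3 g4 g5
  have hC : ∀ z : ℤ, (C z : ℤ[X]) = (z : ℤ[X]) := fun z => by
    simp
  unfold aH fH
  simp only [hC]
  push_cast
  linear_combination 4 * (d : ℤ[X]) * (-(M : ℤ[X]) * X ^ 2 * g1 + (M : ℤ[X]) * X ^ 3 * g2 + X ^ 4 * g3 + X ^ 5 * g4 + X ^ 6 * g5)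

/-- admissible denominators -/
def Adm (a1 a2 : ℚ) (d : ℕ) : Prop :=
  0 < d ∧ d % 2 = 1 ∧ ∃ x y : ℤ, (d : ℚ) * a1 = x ∧ (d : ℚ) * a2 = y ∧ x % 2 = 1 ∧ y % 2 = 0

lemma prim_of_min {a1 a2 : ℚ} {d : ℕ} (hmin : ∀ m < d, ¬ Adm a1 a2 m) (hd : 0 < d)
    (hodd : d % 2 = 1) {x y : ℤ} (hx : (d : ℚ) * a1 = x) (hy : (d : ℚ) * a2 = y)
    (hx2 : x % 2 = 1) (hy2 : y % 2 = 0) (p : ℕ) (hp : p.Prime) : ¬ C (p : ℤ) ∣ aH d x y := by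
  intro h
  rw [C_dvd_iff_dvd_coeff] at h
  have c0 := h 0
  have c1 := h 1
  have c2 := h 2
  have k0 : (aH d x y).coeff 0 = d := by
    simp only [aH, coeff_add, coeff_C_mul, coeff_X, coeff_X_pow, coeff_C]; norm_num
  have k1 : (aH d x y).coeff 1 = x := by
    simp only [aH, coeff_add, coeff_C_mul, coeff_X, coeff_X_pow, coeff_C]; norm_num
  have k2 : (aH d x y).coeff 2 = y := by
    simp only [aH, coeff_add, coeff_C_mul, coeff_X, coeff_X_pow, coeff_C]; norm_num
  rw [k0] at c0
  rw [k1] at c1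
  rw [k2] at c2
  clear k0 k1 k2 h
  norm_cast at c0
  obtain ⟨d', rfl⟩ := c0
  obtain ⟨x', rfl⟩ := c1
  obtain ⟨y', rfl⟩ := c2
  have hp0 : (p : ℚ) ≠ 0 := by exact_mod_cast hp.ne_zero
  have hp2 : p % 2 = 1 := by
    rcases Nat.mod_two_eq_zero_or_one p with h | h
    · rw [Nat.mul_mod, h] at hodd; simp at hodd
    · exact h
  have hd' : 0 < d' := Nat.pos_of_mul_pos_left hd
  refine hmin d' (by nlinarith [hp.two_le]) ⟨hd', ?_, x', y', ?_, ?_, ?_, ?_⟩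
  · rw [Nat.mul_mod, hp2] at hodd; simpa using hodd
  · apply mul_left_cancel₀ hp0; push_cast at hx; linear_combination hx
  · apply mul_left_cancel₀ hp0; push_cast at hy; linear_combination hy
  · rw [Int.mul_emod] at hx2
    rcases Int.emod_two_eq_zero_or_one x' with h | h
    · rw [h] at hx2; simp at hx2
    · exact h
  · have : (p : ℤ) % 2 = 1 := by omega
    rw [Int.mul_emod, this] at hy2; simpa using hy2

section
variable {K : Type*} [Field K] [NumberField K]

lemma eta_ne (r : 𝓞 K) (hx : aeval (r : K) qE = 0) : ((etaE r : 𝓞 K) : K) ≠ 0 := by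
  intro h
  have h' : etaE r = 0 := by exact_mod_cast h
  have := eta_eq hx
  rw [h'] at this
  norm_num at this

lemma sq_K (hd : Module.finrank ℚ K = 5) {r : 𝓞 K} (hx : aeval (r : K) qE = 0)
    {a1 a2 b0 b1 w2 w1 w0 : ℚ}
    (e1 : 0 = -(w2 + a1)) (e2 : 2 = -(w1 + a1 * w2 + a2))
    (e3 : b1 ^ 2 - 2 = -(w0 + a1 * w1 + a2 * w2))
    (e4 : 2 * b1 * b0 + b1 + 1 = -(a1 * w0 + a2 * w1)) (e5 : b0 ^ 2 + b0 = -(a2 * w0))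
    (hadm : ∃ d, Adm a1 a2 d) :
    ∃ s : K, s ^ 2 = ((etaE r : 𝓞 K) : K)⁻¹ ^ 2 + a1 * ((etaE r : 𝓞 K) : K)⁻¹ + a2 := by
  classical
  have hD := Nat.find_spec hadm
  have hmin : ∀ m < Nat.find hadm, ¬ Adm a1 a2 m := fun m hm => Nat.find_min hadm hm
  set d := Nat.find hadm
  obtain ⟨hd0, hodd, x, y, hxd, hyd, hx2, hy2⟩ := hD
  have hprim := prim_of_min hmin hd0 hodd hxd hyd hx2 hy2
  have hs := sol_exists e1 e2 e3 e4 e5 hd0 hxd hyd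
  obtain ⟨hn0, B, W, h⟩ := Nat.find_spec hs
  have hmin2 : ∀ m, 0 < m → m < Nat.find hs → ¬ Sol (aH d x y) m :=
    fun m h0 hm hc => Nat.find_min hs hm ⟨h0, hc⟩
  obtain ⟨c, β, hc, hβ⟩ := square_eta hd hx (a0 := (d : ℤ)) (by omega) (by omega) hx2 hy2 hprim hn0
    hmin2 h
  have hη := eta_ne r hx
  have hβ' := congrArg (algebraMap (𝓞 K) K) hβ
  simp only [map_add, map_mul, map_pow, map_intCast] at hβ'
  have hcK : ((d : ℚ) : K) = (c : K) ^ 2 := by exact_mod_cast congrArg (Int.cast : ℤ → K) hc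
  have hxK : ((d : ℚ) : K) * (a1 : K) = (x : K) := by exact_mod_cast congrArg (Rat.cast : ℚ → K) hxd
  have hyK : ((d : ℚ) : K) * (a2 : K) = (y : K) := by exact_mod_cast congrArg (Rat.cast : ℚ → K) hyd
  have hdne : ((d : ℚ) : K) ≠ 0 := by
    have : d ≠ 0 := hd0.ne'
    exact_mod_cast this
  have hc0 : (c : K) ≠ 0 := by
    intro h0; rw [h0] at hcK; apply hdne; rw [hcK]; ring
  set η : K := algebraMap (𝓞 K) K (etaE r) with hηd
  set b : K := algebraMap (𝓞 K) K β
  refine ⟨b / (c * η), ?_⟩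
  have hi : ((d : ℤ) : K) = ((d : ℚ) : K) := by push_cast; rfl
  rw [hi, ← hxK, ← hyK, hcK] at hβ'
  change _ = η⁻¹ ^ 2 + a1 * η⁻¹ + a2
  have hη' : η ≠ 0 := hη
  rw [div_pow, ← hβ']
  field_simp
end
end

section
open Polynomial NumberField

/-- the quintic `4 F + 1` -/
noncomputable def GX : ℚ[X] := 4 * X ^ 5 - 8 * X ^ 3 + 8 * X ^ 2 - 4 * X + 1

lemma GX_deg : GX.natDegree = 5 := by unfold GX; compute_degree!

/-- the quadratic over `ℚ` -/
noncomputable def aQ (a1 a2 : ℚ) : ℚ[X] := X ^ 2 + C a1 * X + C a2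

lemma aQ_deg (a1 a2 : ℚ) : (aQ a1 a2).natDegree = 2 := by unfold aQ; compute_degree!

lemma aG_rel {a1 a2 b0 b1 w2 w1 w0 : ℚ}
    (e1 : 0 = -(w2 + a1)) (e2 : 2 = -(w1 + a1 * w2 + a2))
    (e3 : b1 ^ 2 - 2 = -(w0 + a1 * w1 + a2 * w2))
    (e4 : 2 * b1 * b0 + b1 + 1 = -(a1 * w0 + a2 * w1)) (e5 : b0 ^ 2 + b0 = -(a2 * w0)) :
    (2 * (C b1 * X + C b0) + 1) ^ 2 +
      4 * aQ a1 a2 * (X ^ 3 + C w2 * X ^ 2 + C w1 * X + C w0) = GX := by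
  have g1 := congrArg (C : ℚ → ℚ[X]) e1
  have g2 := congrArg (C : ℚ → ℚ[X]) e2
  have g3 := congrArg (C : ℚ → ℚ[X]) e3
  have g4 := congrArg (C : ℚ → ℚ[X]) e4
  have g5 := congrArg (C : ℚ → ℚ[X]) e5
  have c2 : (C (2 : ℚ) : ℚ[X]) = 2 := rfl
  simp only [map_add, map_mul, map_neg, map_sub, map_pow, map_one, map_zero, c2] at g1 g2 g3 g4 g5
  unfold aQ GX
  linear_combination 4 * (X ^ 4 * g1 + X ^ 3 * g2 + X ^ 2 * g3 + X * g4 + g5)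

lemma aG_coprime {a1 a2 b0 b1 w2 w1 w0 : ℚ}
    (e1 : 0 = -(w2 + a1)) (e2 : 2 = -(w1 + a1 * w2 + a2))
    (e3 : b1 ^ 2 - 2 = -(w0 + a1 * w1 + a2 * w2))
    (e4 : 2 * b1 * b0 + b1 + 1 = -(a1 * w0 + a2 * w1)) (e5 : b0 ^ 2 + b0 = -(a2 * w0))
    (hN : (2 * b1) ^ 2 * a2 - a1 * (2 * b1) * (2 * b0 + 1) + (2 * b0 + 1) ^ 2 ≠ 0) :
    IsCoprime (aQ a1 a2) GX := by
  have h := aG_rel e1 e2 e3 e4 e5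
  set N := (2 * b1) ^ 2 * a2 - a1 * (2 * b1) * (2 * b0 + 1) + (2 * b0 + 1) ^ 2 with hNd
  set w : ℚ[X] := X ^ 3 + C w2 * X ^ 2 + C w1 * X + C w0
  set L : ℚ[X] := 2 * C b1 * X + (C a1 * (2 * C b1) - (2 * C b0 + 1)) with hL
  have c2 : (C (2 : ℚ) : ℚ[X]) = 2 := rfl
  have hNC : C N = (2 * C b1) ^ 2 * aQ a1 a2 - (2 * (C b1 * X + C b0) + 1) * L := by
    rw [hNd, hL]; unfold aQ
    simp only [map_add, map_mul, map_sub, map_pow, map_one, c2]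
    ring
  have hi : C (N⁻¹) * C N = 1 := by rw [← C_mul, inv_mul_cancel₀ hN, C_1]
  refine ⟨-(C N⁻¹) ^ 2 * (4 * w * L ^ 2 + (2 * C b1) ^ 4 * aQ a1 a2 - 2 * (2 * C b1) ^ 2 * C N),
    (C N⁻¹) ^ 2 * L ^ 2, ?_⟩
  have hN2 : (C N - (2 * C b1) ^ 2 * aQ a1 a2) ^ 2 = (2 * (C b1 * X + C b0) + 1) ^ 2 * L ^ 2 := by
    rw [hNC]; ring
  have : (C N⁻¹ * C N) ^ 2 = 1 := by rw [hi, one_pow]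
  linear_combination this - (C N⁻¹) ^ 2 * hN2 - (C N⁻¹) ^ 2 * L ^ 2 * h

section
variable {K : Type*} [Field K] [NumberField K]

lemma xi_root {r : 𝓞 K} (hx : aeval (r : K) qE = 0) :
    4 * ((etaE r : 𝓞 K) : K)⁻¹ ^ 5 - 8 * ((etaE r : 𝓞 K) : K)⁻¹ ^ 3 +
      8 * ((etaE r : 𝓞 K) : K)⁻¹ ^ 2 - 4 * ((etaE r : 𝓞 K) : K)⁻¹ + 1 = 0 := by
  have hη := eta_ne r hx
  have h := congrArg (algebraMap (𝓞 K) K) (eta_eq hx)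
  rw [map_add, map_sub, map_add, map_sub, map_mul, map_mul, map_mul, map_pow, map_pow, map_pow,
      map_pow, map_ofNat (algebraMap (𝓞 K) K) 4, map_ofNat (algebraMap (𝓞 K) K) 8, map_zero] at h
  set η : K := algebraMap (𝓞 K) K (etaE r)
  change 4 * η⁻¹ ^ 5 - 8 * η⁻¹ ^ 3 + 8 * η⁻¹ ^ 2 - 4 * η⁻¹ + 1 = 0
  have hη' : η ≠ 0 := hη
  field_simp
  linear_combination h

open IntermediateField in
lemma GX_dvd {r : 𝓞 K} (hx : aeval (r : K) qE = 0) {P : ℚ[X]}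
    (hP : aeval (((etaE r : 𝓞 K) : K)⁻¹) P = 0) : GX ∣ P := by
  set ξ : K := ((etaE r : 𝓞 K) : K)⁻¹ with hξ
  have hG : aeval ξ GX = 0 := by
    have h := xi_root hx
    unfold GX
    rw [map_add, map_sub, map_add, map_sub, map_mul, map_mul, map_mul, map_mul, map_pow, map_pow,
      map_pow, map_ofNat (aeval ξ) 4, map_ofNat (aeval ξ) 8, map_one, aeval_X]
    exact h
  have hmem : (r : K) ∈ ℚ⟮ξ⟯ := by
    have h1 : ξ ∈ ℚ⟮ξ⟯ := mem_adjoin_simple_self ℚ ξ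
    have h2 : ((etaE r : 𝓞 K) : K) ∈ ℚ⟮ξ⟯ := by
      have := inv_mem h1
      rwa [hξ, inv_inv] at this
    have h3 := congrArg (algebraMap (𝓞 K) K) (two_r hx)
    rw [map_add, map_sub, map_add, map_mul, map_mul, map_mul, map_neg, map_pow, map_pow,
      map_ofNat (algebraMap (𝓞 K) K) 4, map_ofNat (algebraMap (𝓞 K) K) 2] at h3
    set η : K := algebraMap (𝓞 K) K (etaE r)
    have h4 : (r : K) = (-4 + 4 * η - 2 * η ^ 2 + η ^ 3) / 2 := by
      rw [← h3]; field_simp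
    have h2' : η ∈ ℚ⟮ξ⟯ := h2
    rw [h4]
    refine div_mem (add_mem (sub_mem (add_mem (neg_mem (ofNat_mem _ 4)) (mul_mem (ofNat_mem _ 4) h2'))
      (mul_mem (ofNat_mem _ 2) (pow_mem h2' 2))) (pow_mem h2' 3)) (ofNat_mem _ 2)
  have hle : ℚ⟮(r : K)⟯ ≤ ℚ⟮ξ⟯ := adjoin_simple_le_iff.mpr hmem
  have hIntegral : ∀ z : K, IsIntegral ℚ z := fun z => Algebra.IsIntegral.isIntegral z
  have hfin : Module.finrank ℚ ℚ⟮(r : K)⟯ ≤ Module.finrank ℚ ℚ⟮ξ⟯ :=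
    Submodule.finrank_mono (s := ℚ⟮(r : K)⟯.toSubmodule) (t := ℚ⟮ξ⟯.toSubmodule) hle
  rw [adjoin.finrank (hIntegral _), adjoin.finrank (hIntegral _), minpoly_of_root hx,
    qE_monic.natDegree_map, qE_natDegree] at hfin
  obtain ⟨u, hu⟩ := minpoly.dvd ℚ ξ hG
  have hG0 : GX ≠ 0 := by
    intro h; have := GX_deg; rw [h] at this; simp at this
  have hm0 : minpoly ℚ ξ ≠ 0 := minpoly.ne_zero (hIntegral ξ)
  have hu0 : u ≠ 0 := by rintro rfl; exact hG0 (by rw [hu, mul_zero])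
  have hdeg := GX_deg
  rw [hu, natDegree_mul hm0 hu0] at hdeg
  have hunit : IsUnit u := Polynomial.isUnit_iff_degree_eq_zero.mpr
    (by rw [degree_eq_natDegree hu0, show u.natDegree = 0 by omega]; rfl)
  rw [hu, hunit.mul_right_dvd]
  exact minpoly.dvd ℚ ξ hP

lemma halving_of_sq (hd : Module.finrank ℚ K = 5) {r : 𝓞 K} (hx : aeval (r : K) qE = 0)
    {a1 a2 b0 b1 w2 w1 w0 : ℚ}
    (e1 : 0 = -(w2 + a1)) (e2 : 2 = -(w1 + a1 * w2 + a2))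
    (e3 : b1 ^ 2 - 2 = -(w0 + a1 * w1 + a2 * w2))
    (e4 : 2 * b1 * b0 + b1 + 1 = -(a1 * w0 + a2 * w1)) (e5 : b0 ^ 2 + b0 = -(a2 * w0))
    (hN : (2 * b1) ^ 2 * a2 - a1 * (2 * b1) * (2 * b0 + 1) + (2 * b0 + 1) ^ 2 ≠ 0)
    {s : K} (hs : s ^ 2 = ((etaE r : 𝓞 K) : K)⁻¹ ^ 2 + a1 * ((etaE r : 𝓞 K) : K)⁻¹ + a2) :
    ∃ v : Fin 6 → ℚ, v ≠ 0 ∧ Halving (v 0) (v 1) (v 2 + a1 * v 1)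
      (v 0 * b1 + a1 * v 2 + a2 * v 1) (v 0 * b0 + a2 * v 2) a1 a2 (v 3) (v 4) (v 5) := by
  have hdvd := fun P => GX_dvd (P := P) hx
  have hroot := xi_root hx
  set ξ : K := ((etaE r : 𝓞 K) : K)⁻¹ with hξ
  let u : Fin 6 → K := ![2 * (b1 * ξ + b0) + 1, 2 * (ξ ^ 2 + a1 * ξ + a2) * ξ,
    2 * (ξ ^ 2 + a1 * ξ + a2), -2 * s * ξ ^ 2, -2 * s * ξ, -2 * s]
  have hdep : ¬ LinearIndependent ℚ u := by
    intro h
    have := h.fintype_card_le_finrank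
    rw [hd] at this
    simp at this
  obtain ⟨v, hv, i, hi⟩ := Fintype.not_linearIndependent_iff.mp hdep
  refine ⟨v, fun h => hi (by rw [h]; rfl), ?_⟩
  simp only [Fin.sum_univ_six, u, Matrix.cons_val, Rat.smul_def] at hv
  generalize v 0 = μ at *
  generalize v 1 = l1 at *
  generalize v 2 = l0 at *
  generalize v 3 = c0 at *
  generalize v 4 = c1 at *
  generalize v 5 = c2 at *
  obtain ⟨p6, hp6⟩ : ∃ p, p = l1 ^ 2 - c0 ^ 2 := ⟨_, rfl⟩
  obtain ⟨E2, hE2⟩ : ∃ p, p = l0 + a1 * l1 := ⟨_, rfl⟩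
  obtain ⟨E1, hE1⟩ : ∃ p, p = μ * b1 + a1 * l0 + a2 * l1 := ⟨_, rfl⟩
  obtain ⟨E0, hE0⟩ : ∃ p, p = μ * b0 + a2 * l0 := ⟨_, rfl⟩
  rw [← hE2, ← hE1, ← hE0]
  obtain ⟨p5, hp5⟩ : ∃ p, p = 2 * l1 * E2 - μ ^ 2 - (2 * c0 * c1 + a1 * c0 ^ 2) := ⟨_, rfl⟩
  obtain ⟨p4, hp4⟩ : ∃ p, p = E2 ^ 2 + 2 * l1 * E1 -
    (c1 ^ 2 + 2 * c0 * c2 + 2 * c0 * c1 * a1 + a2 * c0 ^ 2) := ⟨_, rfl⟩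
  obtain ⟨p3, hp3⟩ : ∃ p, p = 2 * l1 * E0 + 2 * E2 * E1 + μ * l1 + 2 * μ ^ 2 -
    (2 * c1 * c2 + a1 * (c1 ^ 2 + 2 * c0 * c2) + 2 * c0 * c1 * a2) := ⟨_, rfl⟩
  obtain ⟨p2, hp2⟩ : ∃ p, p = E1 ^ 2 + 2 * E2 * E0 + μ * E2 - 2 * μ ^ 2 -
    (c2 ^ 2 + 2 * c1 * c2 * a1 + a2 * (c1 ^ 2 + 2 * c0 * c2)) := ⟨_, rfl⟩
  obtain ⟨p1, hp1⟩ : ∃ p, p = 2 * E1 * E0 + μ * E1 + μ ^ 2 -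
    (a1 * c2 ^ 2 + 2 * c1 * c2 * a2) := ⟨_, rfl⟩
  obtain ⟨p0, hp0⟩ : ∃ p, p = E0 ^ 2 + μ * E0 - a2 * c2 ^ 2 := ⟨_, rfl⟩
  obtain ⟨P, hP⟩ : ∃ P : ℚ[X], P = C p6 * X ^ 6 + C p5 * X ^ 5 + C p4 * X ^ 4 + C p3 * X ^ 3 +
    C p2 * X ^ 2 + C p1 * X + C p0 := ⟨_, rfl⟩
  have hPd : P.natDegree ≤ 6 := by rw [hP]; compute_degree
  have C2 : (C (2 : ℚ) : ℚ[X]) = 2 := rfl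
  have hPG : GX ∣ P := by
    apply hdvd
    rw [hP]
    simp only [map_add, map_mul, map_pow, aeval_X, aeval_C, eq_ratCast]
    have four : (4 : K) ≠ 0 := by norm_num
    apply mul_left_cancel₀ four
    rw [hp6, hp5, hp4, hp3, hp2, hp1, hp0, hE2, hE1, hE0]
    push_cast
    set A : K := ξ ^ 2 + a1 * ξ + a2 with hA
    set cc : K := c0 * ξ ^ 2 + c1 * ξ + c2 with hcc
    set ee : K := 2 * (μ * (b1 * ξ + b0) + A * (l1 * ξ + l0)) + μ with hee
    have k1 : ee = 2 * s * cc := by rw [hee, hcc]; linear_combination hv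
    have k2 : ee ^ 2 = 4 * A * cc ^ 2 := by rw [k1]; linear_combination 4 * cc ^ 2 * hs
    rw [hee, hcc, hA] at k2
    linear_combination k2 - μ ^ 2 * hroot
  have hPa : aQ a1 a2 ∣ P := by
    have h := aG_rel e1 e2 e3 e4 e5
    have h4 : aQ a1 a2 ∣ 4 * P := by
      refine ⟨4 * (2 * (C μ * (C b1 * X + C b0)) + C μ) * (C l1 * X + C l0) +
        4 * aQ a1 a2 * (C l1 * X + C l0) ^ 2 -
        4 * (C c0 * X ^ 2 + C c1 * X + C c2) ^ 2 -
        4 * (C μ) ^ 2 * (X ^ 3 + C w2 * X ^ 2 + C w1 * X + C w0), ?_⟩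
      rw [hP, hp6, hp5, hp4, hp3, hp2, hp1, hp0, hE2, hE1, hE0]
      simp only [map_add, map_mul, map_sub, map_pow, C2]
      unfold aQ GX at h
      unfold aQ
      linear_combination (C μ) ^ 2 * h
    have hu4 : IsUnit (4 : ℚ[X]) := by
      have : (4 : ℚ[X]) = C 4 := rfl
      rw [this, isUnit_C]; norm_num
    exact hu4.dvd_mul_left.mp h4
  have hdiv := (aG_coprime e1 e2 e3 e4 e5 hN).mul_dvd hPa hPG
  have hP0 : P = 0 := by
    apply eq_zero_of_dvd_of_natDegree_lt hdiv
    have ha0 : aQ a1 a2 ≠ 0 := by intro h; have := aQ_deg a1 a2; rw [h] at this; simp at this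
    have hG0 : GX ≠ 0 := by intro h; have := GX_deg; rw [h] at this; simp at this
    rw [natDegree_mul ha0 hG0, aQ_deg, GX_deg]
    omega
  rw [hP0] at hP
  have q := fun i => congrArg (fun f : ℚ[X] => f.coeff i) hP
  simp only [coeff_zero, coeff_add, coeff_C_mul, coeff_X_pow, coeff_X, coeff_C] at q
  have q0 := q 0
  have q1 := q 1
  have q2 := q 2
  have q3 := q 3
  have q4 := q 4
  have q5 := q 5
  have q6 := q 6
  norm_num at q0 q1 q2 q3 q4 q5 q6
  refine ⟨?_, ?_, ?_, ?_, ?_, ?_, ?_⟩ <;> linarith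
end
end

section
open Polynomial NumberField

lemma A2.den_odd (x : A2) : (x : ℚ).den % 2 = 1 := by
  have h := PadicInt.isUnit_den (p := 2) (x : ℚ) (mem_A2.1 x.2)
  by_contra hc
  have h2 : ((2 : ℕ) : ℤ_[2]) ∣ ((x : ℚ).den : ℤ_[2]) :=
    Nat.cast_dvd_cast (Nat.dvd_of_mod_eq_zero (by omega))
  rw [← PadicInt.norm_lt_one_iff_dvd, PadicInt.isUnit_iff.mp h] at h2
  exact lt_irrefl _ h2

lemma adm_exists {a1 a2 : A2} (h1 : A2.red a1 = 1) (h2 : A2.red a2 = 0) :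
    ∃ d, Adm (a1 : ℚ) (a2 : ℚ) d := by
  have o1 := A2.den_odd a1
  have o2 := A2.den_odd a2
  obtain ⟨z, hz⟩ := A2.two_dvd (x := a1 - 1) (by rw [map_sub, h1, map_one, sub_self])
  obtain ⟨t, ht⟩ := A2.two_dvd h2
  have oz := A2.den_odd z
  have ot := A2.den_odd t
  have hz' : (a1 : ℚ) - 1 = 2 * (z : ℚ) := congrArg (Subtype.val) hz
  have ht' : (a2 : ℚ) = 2 * (t : ℚ) := congrArg (Subtype.val) ht
  have n1 := Rat.den_mul_eq_num (a1 : ℚ)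
  have n2 := Rat.den_mul_eq_num (a2 : ℚ)
  have nz := Rat.den_mul_eq_num (z : ℚ)
  have nt := Rat.den_mul_eq_num (t : ℚ)
  have k1 : (a1 : ℚ).num * (z : ℚ).den = (a1 : ℚ).den * ((z : ℚ).den + 2 * (z : ℚ).num) := by
    have : ((a1 : ℚ).num : ℚ) * (z : ℚ).den =
        (a1 : ℚ).den * ((z : ℚ).den + 2 * (z : ℚ).num) := by
      rw [← n1, ← nz]
      linear_combination ((a1 : ℚ).den : ℚ) * (z : ℚ).den * hz'
    exact_mod_cast this
  have k2 : (a2 : ℚ).num * (t : ℚ).den = 2 * ((a2 : ℚ).den * (t : ℚ).num) := by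
    have : ((a2 : ℚ).num : ℚ) * (t : ℚ).den = 2 * ((a2 : ℚ).den * (t : ℚ).num) := by
      rw [← n2, ← nt]
      linear_combination ((a2 : ℚ).den : ℚ) * (t : ℚ).den * ht'
    exact_mod_cast this
  have O : ∀ {n : ℕ}, n % 2 = 1 → Odd (n : ℤ) := fun {n} h => by
    exact_mod_cast Nat.odd_iff.mpr h
  have p1 : Odd (a1 : ℚ).num := by
    have : Odd ((a1 : ℚ).num * (z : ℚ).den) := by
      rw [k1]
      exact (O o1).mul ((O oz).add_even (even_two_mul _))
    exact (Int.odd_mul.mp this).1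
  have p2 : Even (a2 : ℚ).num := by
    have : Even ((a2 : ℚ).num * (t : ℚ).den) := by
      rw [k2]; exact even_two_mul _
    rcases Int.even_mul.mp this with h | h
    · exact h
    · exact absurd (O ot) (Int.not_odd_iff_even.mpr h)
  refine ⟨(a1 : ℚ).den * (a2 : ℚ).den, Nat.mul_pos (Rat.den_pos _) (Rat.den_pos _), ?_,
    (a1 : ℚ).num * (a2 : ℚ).den, (a2 : ℚ).num * (a1 : ℚ).den, ?_, ?_, ?_, ?_⟩
  · exact Nat.odd_iff.mp ((Nat.odd_iff.mpr o1).mul (Nat.odd_iff.mpr o2))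
  · push_cast; linear_combination ((a2 : ℚ).den : ℚ) * n1
  · push_cast; linear_combination ((a1 : ℚ).den : ℚ) * n2
  · exact Int.odd_iff.mp (p1.mul (O o2))
  · exact Int.even_iff.mp (p2.mul_right _)

instance : Fact (Irreducible (qE.map (algebraMap ℤ ℚ))) := ⟨qEQ_irreducible⟩

/-- the quintic field -/
abbrev KE : Type := AdjoinRoot (qE.map (algebraMap ℤ ℚ))

lemma KE_finrank : Module.finrank ℚ KE = 5 := by
  have h := (AdjoinRoot.powerBasis (qEQ_irreducible.ne_zero)).finrank
  rw [h, AdjoinRoot.powerBasis_dim, qE_monic.natDegree_map, qE_natDegree]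

instance : NumberField KE where
  to_charZero := charZero_of_injective_algebraMap (algebraMap ℚ KE).injective
  to_finiteDimensional := Module.finite_of_finrank_pos (by rw [KE_finrank]; norm_num)

theorem halfProp : HalfProp := by
  intro a1 a2 b0 b1 w2 w1 w0 h
  obtain ⟨e1, e2, e3, e4, e5, r1, r2, -⟩ := h
  have f1 : (0 : ℚ) = -((w2 : ℚ) + a1) := congrArg Subtype.val e1
  have f2 : (2 : ℚ) = -((w1 : ℚ) + a1 * w2 + a2) := congrArg Subtype.val e2
  have f3 : (b1 : ℚ) ^ 2 - 2 = -((w0 : ℚ) + a1 * w1 + a2 * w2) := congrArg Subtype.val e3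
  have f4 : 2 * (b1 : ℚ) * b0 + b1 + 1 = -((a1 : ℚ) * w0 + a2 * w1) := congrArg Subtype.val e4
  have f5 : (b0 : ℚ) ^ 2 + b0 = -((a2 : ℚ) * w0) := congrArg Subtype.val e5
  have hroot : aeval (AdjoinRoot.root (qE.map (algebraMap ℤ ℚ)) : KE) qE = 0 := by
    rw [← aeval_map_algebraMap ℚ]
    exact (AdjoinRoot.aeval_eq (qE.map (algebraMap ℤ ℚ))).trans AdjoinRoot.mk_self
  let r : 𝓞 KE := ⟨AdjoinRoot.root (qE.map (algebraMap ℤ ℚ)), ⟨qE, qE_monic, hroot⟩⟩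
  have hx : aeval (r : KE) qE = 0 := hroot
  obtain ⟨s, hs⟩ := sq_K KE_finrank hx f1 f2 f3 f4 f5 (adm_exists r1 r2)
  refine halving_of_sq KE_finrank hx f1 f2 f3 f4 f5 ?_ hs
  have hu := (A2.unit_odd (2 * b1 ^ 2 * a2 - a1 * b1 * (2 * b0 + 1) + 2 * b0 ^ 2 + 2 * b0)).ne_zero
  intro hc
  apply hu
  apply Subtype.ext
  change (1 : ℚ) + 2 * (2 * (b1 : ℚ) ^ 2 * a2 - a1 * b1 * (2 * b0 + 1) + 2 * (b0 : ℚ) ^ 2 + 2 * b0)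
    = 0
  linear_combination hc
end

/-- The only rational points on the genus 2 curve
`y² = x⁶ - 2x⁵ + 3x⁴ - 4x³ - x² + 2x + 1` are `(0, ±1)` and `(1, 0)`. -/
theorem stmt_7 :
    {p : ℚ × ℚ |
        p.2 ^ 2 = p.1 ^ 6 - 2 * p.1 ^ 5 + 3 * p.1 ^ 4 - 4 * p.1 ^ 3 -
          p.1 ^ 2 + 2 * p.1 + 1} =
      ({(0, 1), (0, -1), (1, 0)} : Set (ℚ × ℚ)) := by
  exact final halfProp
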